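/- Let A''₀ = {(θ,λ)}, where λ runs over a set of representatives of the U×U orbits in J* (orbits {uλv : u,v ∈ U}) and θ over the S_{UλU}-irreducible characters of H_{UλU}, and let A'' be the quotient of A''₀ by the conjugation action of L; for α = (θ,λ) let χ''_α be the character induced to G from the character ξ_{θ,λ} of H_{UλU} ⋉ U_{λ,rt}, where ξ_{θ,λ}(h(1+x)) = θ(h)·ε^{λ(x)}. For h ∈ L let J''_h = {x ∈ J : μ(x) = 0 for every μ ∈ J* lying in some orbit UνU all of whose elements are fixed by Ad_h*} and π''_h : J → J/J''_h. Let B''₀ = {(h,ω)}, where h ∈ L and ω runs over the U×U orbits in J/J''_h, let B'' be the quotient of B''₀ by the conjugation action of L, and for β = (h,ω) set K''_β = ∪_{p∈L} p·(h·(1+(π''_h)^{-1}(ω)))·p^{-1}. Then ({χ''_α : α ∈ A''}, {K''_β : β ∈ B''}) is a supercharacter theory of G = L ⋉ U: each χ''_α is the character of a complex representation of G, the χ''_α are pairwise orthogonal, the K''_β form a partition of G one of whose parts is {1}, each χ''_α is constant on each K''_β, and |A''| = |B''|. -/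

import Mathlib

open scoped Classical

section CharacterTheory

open Representation
open scoped ComplexOrder

/-- The complex character of a finite group takes conjugate values at inverse elements. -/
theorem FDRep.conj_character {G : Type} [Group G] [Fintype G] (W : FDRep ℂ G) (g : G) :
    (starRingEnd ℂ) (W.character g) = W.character g⁻¹ := by
  let b := Module.finBasis ℂ W
  let R : G →* Matrix (Fin (Module.finrank ℂ W)) (Fin (Module.finrank ℂ W)) ℂ :=
    ((LinearMap.toMatrixAlgEquiv b : _ ≃ₐ[ℂ] _) : _ →* _).comp W.ρ
  have htr : ∀ h, W.character h = (R h).trace := fun h =>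
    LinearMap.trace_eq_matrix_trace ℂ b (W.ρ h)
  let M := ∑ h : G, (R h).conjTranspose * R h
  have hM : M.PosDef := by
    have : M = 1 + ∑ h ∈ Finset.univ.erase (1 : G), (R h).conjTranspose * R h := by
      simp only [M]
      rw [← Finset.add_sum_erase _ _ (Finset.mem_univ (1 : G))]
      simp
    rw [this]
    exact Matrix.PosDef.one.add_posSemidef
      (Matrix.posSemidef_sum _ fun h _ => Matrix.posSemidef_conjTranspose_mul_self (R h))
  have hinv : (R g).conjTranspose * M * R g = M := by
    simp only [M, Finset.mul_sum, Finset.sum_mul]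
    refine Fintype.sum_equiv (Equiv.mulRight g) _ _ fun h => ?_
    simp [Matrix.conjTranspose_mul, mul_assoc]
  have hgg : R g * R g⁻¹ = 1 := by rw [← map_mul, mul_inv_cancel, map_one]
  have hdet : IsUnit M.det := (Matrix.isUnit_iff_isUnit_det _).1 hM.isUnit
  have hct : (R g).conjTranspose = M * R g⁻¹ * M⁻¹ := by
    calc (R g).conjTranspose = (R g).conjTranspose * M * (R g * R g⁻¹) * M⁻¹ := by
          rw [hgg, mul_one, mul_assoc, Matrix.mul_nonsing_inv _ hdet, mul_one]
      _ = ((R g).conjTranspose * M * R g) * R g⁻¹ * M⁻¹ := by simp only [mul_assoc]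
      _ = _ := by rw [hinv]
  rw [htr, htr, starRingEnd_apply, ← Matrix.trace_conjTranspose, hct, Matrix.trace_mul_comm,
    ← mul_assoc, Matrix.nonsing_inv_mul _ hdet, one_mul]

/-- A central element of the group algebra all of whose irreducible traces vanish annihilates every
simple module. -/
theorem central_smul_eq_zero_of_isSimpleModule {G : Type} [Group G] [Fintype G] (f : G → ℂ)
    (a : MonoidAlgebra ℂ G) (ha : a = ∑ g : G, MonoidAlgebra.single g (f g))
    (hcentral : ∀ h : G, MonoidAlgebra.single h 1 * a = a * MonoidAlgebra.single h 1)
    (horth : ∀ W : FDRep ℂ G, CategoryTheory.Simple W → ∑ g : G, f g * W.character g = 0)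
    (M : Type) [AddCommGroup M] [Module ℂ M] [Module (MonoidAlgebra ℂ G) M]
    [IsScalarTower ℂ (MonoidAlgebra ℂ G) M] [Module.Finite ℂ M]
    [hs : IsSimpleModule (MonoidAlgebra ℂ G) M] (x : M) : a • x = 0 := by
  have hinvb := invertibleOfNonzero (NeZero.ne (Nat.card G : ℂ))
  let σ : Representation ℂ G M := ofModule' M
  have hσ : ∀ (r : MonoidAlgebra ℂ G) (y : M), σ.asAlgebraHom r y = r • y := by
    intro r y
    simp only [σ, ofModule', asAlgebraHom, Equiv.apply_symm_apply]
    rfl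
  have hirr : σ.IsIrreducible := by
    rw [irreducible_iff_isSimpleModule_asModule]
    let e : σ.asModule ≃ₗ[MonoidAlgebra ℂ G] M :=
      { σ.asModuleEquiv.toAddEquiv with
        map_smul' := fun r y => by
          simp [hσ] }
    exact IsSimpleModule.congr e
  have hWsimple : CategoryTheory.Simple (FDRep.of σ) := by
    rw [FDRep.simple_iff_char_is_norm_one]
    have h1 := char_orthonormal σ σ
    rw [if_pos ⟨Representation.Equiv.refl σ⟩] at h1
    rwa [inv_mul_eq_one₀ (NeZero.ne _), eq_comm] at h1
  let T := σ.asAlgebraHom a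
  have hT : T = ∑ g : G, f g • σ g := by
    simp [T, ha, asAlgebraHom_single]
  let I : IntertwiningMap σ σ := ⟨T, fun g => by
    have := congrArg σ.asAlgebraHom (hcentral g)
    simpa [asAlgebraHom_single, T, Module.End.mul_eq_comp] using this.symm⟩
  obtain ⟨c, hc⟩ :=
    (IsIrreducible.algebraMap_intertwiningMap_bijective_of_isAlgClosed (ρ := σ)).2 I
  have hcT : T = c • LinearMap.id := by
    have := congrArg IntertwiningMap.toLinearMap hc
    rw [← show I.toLinearMap = T from rfl, ← this]
    rfl
  have htrace : c * Module.finrank ℂ M = 0 := by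
    rw [← horth _ hWsimple]
    have h1 : LinearMap.trace ℂ M T = c * Module.finrank ℂ M := by
      rw [hcT, map_smul, LinearMap.trace_id, smul_eq_mul]
    rw [← h1, hT, map_sum]
    simp [FDRep.character]
  have hnt : Nontrivial M := IsSimpleModule.nontrivial (MonoidAlgebra ℂ G) M
  have hc0 : c = 0 := by
    refine (mul_eq_zero.1 htrace).resolve_right ?_
    exact_mod_cast (Module.finrank_pos (R := ℂ) (M := M)).ne'
  have hT0 : T = 0 := by rw [hcT, hc0, zero_smul]
  rw [← hσ, show σ.asAlgebraHom a = 0 from hT0, LinearMap.zero_apply]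

/-- A class function orthogonal to every irreducible character vanishes. -/
theorem eq_zero_of_forall_sum_mul_character_eq_zero {G : Type} [Group G] [Fintype G] (f : G → ℂ)
    (hf : ∀ g h : G, f (h * g * h⁻¹) = f g)
    (horth : ∀ W : FDRep ℂ G, CategoryTheory.Simple W → ∑ g : G, f g * W.character g = 0) :
    f = 0 := by
  let a : MonoidAlgebra ℂ G := ∑ g : G, MonoidAlgebra.single g (f g)
  have hcentral : ∀ h : G, MonoidAlgebra.single h 1 * a = a * MonoidAlgebra.single h 1 := by
    intro h
    simp only [a, Finset.mul_sum, Finset.sum_mul, MonoidAlgebra.single_mul_single, one_mul, mul_one]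
    refine Fintype.sum_equiv (MulAut.conj h).toEquiv _ _ fun g => ?_
    simp [hf]
  have hjac : a ∈ Ring.jacobson (MonoidAlgebra ℂ G) := by
    rw [Ring.jacobson, Module.jacobson, Submodule.mem_sInf]
    intro m hm
    have hsimple : IsSimpleModule (MonoidAlgebra ℂ G) (MonoidAlgebra ℂ G ⧸ m) :=
      isSimpleModule_iff_isCoatom.2 hm
    have h2 := central_smul_eq_zero_of_isSimpleModule f a rfl hcentral horth
      (MonoidAlgebra ℂ G ⧸ m) (Submodule.Quotient.mk 1)
    rw [← Submodule.Quotient.mk_smul, smul_eq_mul, mul_one] at h2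
    exact (Submodule.Quotient.mk_eq_zero m).1 h2
  rw [IsSemisimpleRing.jacobson_eq_bot] at hjac
  have ha : a = 0 := by simpa using hjac
  funext g
  have := congrArg (fun x : MonoidAlgebra ℂ G => x.coeff g) ha
  simpa [a, MonoidAlgebra.coeff_single, Finsupp.single_apply] using this

/-- A finite sum of characters is a character. -/
theorem exists_character_eq_sum {G ι : Type} [Group G] (s : Finset ι) (f : ι → G → ℂ)
    (hf : ∀ i ∈ s, ∃ W : FDRep ℂ G, ∀ g, f i g = W.character g) :
    ∃ W : FDRep ℂ G, ∀ g, ∑ i ∈ s, f i g = W.character g := by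
  induction s using Finset.induction_on with
  | empty => exact ⟨FDRep.of (Representation.trivial ℂ G PUnit), fun g => by
      simp [FDRep.character, Subsingleton.elim _ (0 : PUnit →ₗ[ℂ] PUnit)]⟩
  | insert i s his ih =>
    obtain ⟨W, hW⟩ := ih fun j hj => hf j (Finset.mem_insert_of_mem hj)
    obtain ⟨W', hW'⟩ := hf i (Finset.mem_insert_self i s)
    let σ : Representation ℂ G (W' × W) := Representation.prod W'.ρ W.ρ
    refine ⟨FDRep.of σ, fun g => ?_⟩
    rw [Finset.sum_insert his, hW, hW']
    exact (LinearMap.trace_prodMap' (W'.ρ g) (W.ρ g)).symm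

/-- The trace of an endomorphism of a finite power is the sum of the traces of its diagonal
blocks. -/
theorem LinearMap.trace_pi_eq_sum {ι W : Type*} [Fintype ι] [AddCommGroup W] [Module ℂ W]
    [Module.Finite ℂ W] (T : (ι → W) →ₗ[ℂ] (ι → W)) :
    LinearMap.trace ℂ (ι → W) T =
      ∑ i, LinearMap.trace ℂ W (LinearMap.proj i ∘ₗ T ∘ₗ LinearMap.single ℂ (fun _ => W) i) := by
  have hid : T = ∑ i, (T ∘ₗ LinearMap.single ℂ (fun _ => W) i) ∘ₗ LinearMap.proj i := by
    refine LinearMap.ext fun f => ?_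
    simp only [LinearMap.sum_apply, LinearMap.comp_apply, ← map_sum]
    congr 1
    funext j
    simp [LinearMap.single_apply, Finset.sum_apply, Pi.single_apply]
  conv_lhs => rw [hid]
  rw [map_sum]
  exact Finset.sum_congr rfl fun i _ => LinearMap.trace_comp_comm' _ _

/-- The function induced from a character of a subgroup is a character. -/
theorem exists_character_eq_induced {G : Type} [Group G] [Fintype G] (Q : Subgroup G)
    (W : FDRep ℂ Q) :
    ∃ X : FDRep ℂ G, ∀ g, (Nat.card Q : ℂ)⁻¹ *
      ∑ s : G, (if h : s * g * s⁻¹ ∈ Q then W.character ⟨s * g * s⁻¹, h⟩ else 0) =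
        X.character g := by
  let R : G →* ((G → W) →ₗ[ℂ] (G → W)) :=
    { toFun := fun g => LinearMap.funLeft ℂ W (· * g)
      map_one' := by
        refine LinearMap.ext fun f => funext fun s => ?_
        simp [LinearMap.funLeft_apply]
      map_mul' := fun g h => by
        refine LinearMap.ext fun f => funext fun s => ?_
        simp [LinearMap.funLeft_apply, mul_assoc] }
  let E : Submodule ℂ (G → W) :=
    { carrier := {f | ∀ (q : Q) (s : G), f (q * s) = W.ρ q (f s)}
      add_mem' := fun {a b} ha hb q s => by simp [ha q s, hb q s]
      zero_mem' := fun q s => by simp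
      smul_mem' := fun c a ha q s => by simp [ha q s] }
  have hR : ∀ g, ∀ f ∈ E, R g f ∈ E := fun g f hf q s => by
    simpa [R, LinearMap.funLeft_apply, mul_assoc] using hf q (s * g)
  let A : (G → W) →ₗ[ℂ] (G → W) := (Nat.card Q : ℂ)⁻¹ • ∑ q : Q,
    LinearMap.pi fun s => W.ρ q⁻¹ ∘ₗ LinearMap.proj ((q : G) * s)
  have hA : ∀ f s, A f s = (Nat.card Q : ℂ)⁻¹ • ∑ q : Q, W.ρ q⁻¹ (f (q * s)) := fun f s => by
    simp [A, Finset.sum_apply]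
  have hAE : ∀ f, A f ∈ E := fun f q s => by
    rw [hA, hA, map_smul, map_sum]
    congr 1
    refine Fintype.sum_equiv (Equiv.mulRight q) _ _ fun p => ?_
    rw [← Module.End.mul_apply, ← map_mul]
    simp [mul_assoc]
  have hAid : ∀ f ∈ E, A f = f := fun f hf => funext fun s => by
    rw [hA]
    have : ∀ q : Q, W.ρ q⁻¹ (f (q * s)) = f s := fun q => by
      rw [hf, ← Module.End.mul_apply, ← map_mul]
      simp
    simp only [this, Finset.sum_const, Finset.card_univ, ← Nat.card_eq_fintype_card]
    rw [← Nat.cast_smul_eq_nsmul ℂ, smul_smul, inv_mul_cancel₀ (NeZero.ne _), one_smul]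
  let σ : Representation ℂ G E :=
    { toFun := fun g => (R g).restrict (hR g)
      map_one' := LinearMap.ext fun f => Subtype.ext (by simp [LinearMap.restrict_apply])
      map_mul' := fun g h => LinearMap.ext fun f => Subtype.ext
        (by simp [LinearMap.restrict_apply]) }
  refine ⟨FDRep.of σ, fun g => ?_⟩
  have htr : (FDRep.of σ).character g = LinearMap.trace ℂ (G → W) (R g ∘ₗ A) := by
    have h1 : σ g = (A.codRestrict E hAE) ∘ₗ (R g ∘ₗ E.subtype) :=
      LinearMap.ext fun f => Subtype.ext (by
        simpa [σ] using (hAid _ (hR g f f.2)).symm)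
    have h2 : R g ∘ₗ A = (R g ∘ₗ E.subtype) ∘ₗ (A.codRestrict E hAE) :=
      LinearMap.ext fun f => by simp
    rw [h2, LinearMap.trace_comp_comm', ← h1]
    rfl
  rw [htr, LinearMap.trace_pi_eq_sum, Finset.mul_sum]
  refine Finset.sum_congr rfl fun s _ => ?_
  have hblock : LinearMap.proj s ∘ₗ (R g ∘ₗ A) ∘ₗ LinearMap.single ℂ (fun _ => W) s =
      (Nat.card Q : ℂ)⁻¹ • (if h : s * g * s⁻¹ ∈ Q then W.ρ ⟨s * g * s⁻¹, h⟩ else 0) := by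
    refine LinearMap.ext fun w => ?_
    have h1 : (LinearMap.proj s ∘ₗ (R g ∘ₗ A) ∘ₗ LinearMap.single ℂ (fun _ => W) s) w =
        (Nat.card Q : ℂ)⁻¹ • ∑ q : Q, W.ρ q⁻¹ ((Pi.single s w : G → W) (q * (s * g))) :=
      hA _ _
    rw [h1, LinearMap.smul_apply]
    congr 1
    by_cases h : s * g * s⁻¹ ∈ Q
    · rw [dif_pos h, Fintype.sum_eq_single (⟨s * g * s⁻¹, h⟩⁻¹ : Q)]
      · simp [mul_assoc]
      · intro q hq
        rw [Pi.single_apply, if_neg, map_zero]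
        intro hqs
        refine hq (Subtype.ext ?_)
        simp only [InvMemClass.coe_inv]
        rw [eq_inv_iff_mul_eq_one, ← mul_assoc, hqs, mul_inv_cancel]
    · rw [dif_neg h, LinearMap.zero_apply]
      refine Finset.sum_eq_zero fun q _ => ?_
      rw [Pi.single_apply, if_neg, map_zero]
      intro hqs
      refine h ?_
      have : s * g * s⁻¹ = (q : G)⁻¹ := by
        rw [eq_inv_mul_iff_mul_eq.2 hqs, mul_inv_cancel_right]
      rw [this]
      exact inv_mem q.2
  rw [hblock, map_smul, smul_eq_mul]
  congr 1
  split_ifs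
  · rfl
  · simp

end CharacterTheory

section Counting

/-- The left kernel and right kernel of a rectangular complex matrix being trivial forces it to be
square. -/
theorem Nat.card_eq_of_linearIndependent_of_separating {ι κ : Type} [Fintype κ] (M : ι → κ → ℂ)
    (hli : LinearIndependent ℂ M)
    (hsep : ∀ φ : κ → ℂ, (∀ i, ∑ b, φ b * M i b = 0) → φ = 0) : Nat.card ι = Nat.card κ := by
  have htop : ⊤ ≤ Submodule.span ℂ (Set.range M) := by
    by_contra hne
    obtain ⟨φ, hφ0, hφ⟩ := Submodule.exists_le_ker_of_lt_top _
      (lt_top_iff_ne_top.2 fun h => hne h.ge)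
    have hφs : ∀ v : κ → ℂ, φ v = ∑ b, φ (Pi.single b 1) * v b := fun v => by
      conv_lhs => rw [pi_eq_sum_univ' v]
      rw [map_sum]
      refine Finset.sum_congr rfl fun b _ => ?_
      rw [map_smul, smul_eq_mul, mul_comm]
    have h0 := hsep (fun b => φ (Pi.single b 1)) fun i => by
      rw [← hφs]
      exact hφ (Submodule.subset_span ⟨i, rfl⟩)
    refine hφ0 (LinearMap.ext fun v => ?_)
    rw [hφs]
    simp [fun b => congrFun h0 b]
  have hb := Module.finrank_eq_nat_card_basis (Module.Basis.mk hli htop)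
  rw [← hb, Module.finrank_fintype_fun_eq_card, Nat.card_eq_fintype_card]

variable {G A B : Type} (A0 : Set A) (B0 : Set B) (χ : A → G → ℂ) (K : B → Set G)
  (RelA : A → A → Prop) (RelB : B → B → Prop)

/-- The classes of a relation on the index set that detects equality of cells partition the
underlying set. -/
theorem existsUnique_cell
    (hB1 : ∀ β ∈ B0, ∀ β' ∈ B0, RelB β β' → K β = K β')
    (hB2 : ∀ β ∈ B0, ∀ β' ∈ B0, ∀ g, g ∈ K β → g ∈ K β' → RelB β β')
    (hB3 : ∀ β ∈ B0, (K β).Nonempty) (hB4 : ∀ g, ∃ β ∈ B0, g ∈ K β) (g : G) :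
    ∃! S, S ∈ {S : Set B | ∃ β ∈ B0, S = {β' ∈ B0 | RelB β β'}} ∧ ∃ β ∈ S, g ∈ K β := by
  have hiff : ∀ β ∈ B0, ∀ β' ∈ B0, (RelB β β' ↔ K β = K β') := fun β hβ β' hβ' =>
    ⟨hB1 β hβ β' hβ', fun h => by
      obtain ⟨x, hx⟩ := hB3 β hβ
      exact hB2 β hβ β' hβ' x hx (h ▸ hx)⟩
  obtain ⟨β, hβ, hg⟩ := hB4 g
  refine ⟨{β' ∈ B0 | RelB β β'}, ⟨⟨β, hβ, rfl⟩, β, ⟨hβ, (hiff β hβ β hβ).2 rfl⟩, hg⟩, ?_⟩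
  rintro S ⟨⟨γ, hγ, rfl⟩, δ, ⟨hδ, hγδ⟩, hgδ⟩
  have h1 : K γ = K β :=
    (hB1 γ hγ δ hδ hγδ).trans (hB1 δ hδ β hβ (hB2 δ hδ β hβ g hgδ hg))
  ext ζ
  simp only [Set.mem_ofPred_eq]
  refine and_congr_right fun hζ => ?_
  rw [hiff γ hγ ζ hζ, hiff β hβ ζ hζ, h1]

/-- The number of pairwise orthogonal functions that are constant on, and separate, the cells of a
partition is the number of cells. -/
theorem card_classes_eq [Fintype G]
    (hA1 : ∀ α ∈ A0, ∀ α' ∈ A0, RelA α α' → χ α = χ α')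
    (hA2 : ∀ α ∈ A0, ∀ α' ∈ A0, ¬ RelA α α' → ∑ g, χ α g * (starRingEnd ℂ) (χ α' g) = 0)
    (hA3 : ∀ α ∈ A0, χ α ≠ 0)
    (hB1 : ∀ β ∈ B0, ∀ β' ∈ B0, RelB β β' → K β = K β')
    (hB2 : ∀ β ∈ B0, ∀ β' ∈ B0, ∀ g, g ∈ K β → g ∈ K β' → RelB β β')
    (hB3 : ∀ β ∈ B0, (K β).Nonempty) (hB4 : ∀ g, ∃ β ∈ B0, g ∈ K β)
    (hconst : ∀ α ∈ A0, ∀ β ∈ B0, ∀ g ∈ K β, ∀ g' ∈ K β, χ α g = χ α g')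
    (hsep : ∀ f : G → ℂ, (∀ β ∈ B0, ∀ g ∈ K β, ∀ g' ∈ K β, f g = f g') →
      (∀ α ∈ A0, ∑ g, χ α g * f g = 0) → f = 0) :
    Nat.card {S : Set A | ∃ α ∈ A0, S = {α' ∈ A0 | RelA α α'}} =
      Nat.card {S : Set B | ∃ β ∈ B0, S = {β' ∈ B0 | RelB β β'}} := by
  have hself : ∀ α ∈ A0, ∑ g, χ α g * (starRingEnd ℂ) (χ α g) ≠ 0 := fun α hα h => by
    refine hA3 α hα (funext fun g => ?_)
    simp only [Complex.mul_conj] at h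
    norm_cast at h
    rw [Finset.sum_eq_zero_iff_of_nonneg fun g _ => Complex.normSq_nonneg _] at h
    exact Complex.normSq_eq_zero.1 (h g (Finset.mem_univ g))
  have hiff : ∀ α ∈ A0, ∀ α' ∈ A0, (RelA α α' ↔ χ α = χ α') := fun α hα α' hα' =>
    ⟨hA1 α hα α' hα', fun h => by
      by_contra hn
      have := hA2 α hα α' hα' hn
      rw [← h] at this
      exact hself α hα this⟩
  set OA := {S : Set A | ∃ α ∈ A0, S = {α' ∈ A0 | RelA α α'}}
  set OB := {S : Set B | ∃ β ∈ B0, S = {β' ∈ B0 | RelB β β'}} with hOB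
  have hcell := existsUnique_cell B0 K RelB hB1 hB2 hB3 hB4
  choose c hc huniq using hcell
  let c' : G → OB := fun g => ⟨c g, (hc g).1⟩
  have hcsurj : Function.Surjective c' := by
    rintro ⟨S, β, hβ, rfl⟩
    obtain ⟨g, hg⟩ := hB3 β hβ
    refine ⟨g, Subtype.ext ?_⟩
    refine (huniq g _ ⟨⟨β, hβ, rfl⟩, β, ⟨hβ, hB2 β hβ β hβ g hg hg⟩, hg⟩).symm
  have hceq : ∀ g g', c' g = c' g' → ∃ β ∈ B0, g ∈ K β ∧ g' ∈ K β := fun g g' h => by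
    obtain ⟨⟨β, hβ, hS⟩, δ, hδ, hgδ⟩ := hc g
    obtain ⟨⟨β', hβ', hS'⟩, δ', hδ', hgδ'⟩ := hc g'
    have h' : c g = c g' := congrArg Subtype.val h
    rw [← h', hS] at hδ'
    rw [hS] at hδ
    refine ⟨β, hβ, ?_, ?_⟩
    · rwa [hB1 β hβ δ hδ.1 hδ.2]
    · rwa [hB1 β hβ δ' hδ'.1 hδ'.2]
  have hceq' : ∀ β ∈ B0, ∀ g ∈ K β, ∀ g' ∈ K β, c' g = c' g' := fun β hβ g hg g' hg' => by
    refine Subtype.ext ?_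
    have h1 := hB2 β hβ β hβ g hg hg
    exact (huniq g _ ⟨⟨β, hβ, rfl⟩, β, ⟨hβ, h1⟩, hg⟩).symm.trans
      (huniq g' _ ⟨⟨β, hβ, rfl⟩, β, ⟨hβ, h1⟩, hg'⟩)
  have : Finite OB := Finite.of_surjective c' hcsurj
  have := Fintype.ofFinite OB
  choose rep hrep hrepS using fun S : OA => S.2
  choose sec hsec using hcsurj
  have hχc : ∀ α ∈ A0, ∀ g, χ α (sec (c' g)) = χ α g := fun α hα g => by
    obtain ⟨β, hβ, h1, h2⟩ := hceq _ _ (hsec (c' g))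
    exact hconst α hα β hβ _ h1 _ h2
  refine Nat.card_eq_of_linearIndependent_of_separating
    (fun (S : OA) (b : OB) => χ (rep S) (sec b)) ?_ ?_
  · have hli : LinearIndependent ℂ (fun S : OA => χ (rep S)) := by
      rw [linearIndependent_iff']
      intro s a ha S hS
      have h1 : ∑ g, (∑ T ∈ s, a T • χ (rep T)) g * (starRingEnd ℂ) (χ (rep S) g) = 0 := by
        rw [ha]; simp
      simp only [Finset.sum_apply, Pi.smul_apply, smul_eq_mul, Finset.sum_mul] at h1
      rw [Finset.sum_comm, Finset.sum_eq_single S] at h1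
      · simp only [mul_assoc, ← Finset.mul_sum] at h1
        exact (mul_eq_zero.1 h1).resolve_right (hself _ (hrep S))
      · intro T _ hTS
        simp only [mul_assoc, ← Finset.mul_sum]
        rw [hA2 _ (hrep T) _ (hrep S), mul_zero]
        intro hrel
        refine hTS (Subtype.ext ?_)
        rw [hrepS T, hrepS S]
        ext α
        simp only [Set.mem_ofPred_eq]
        refine and_congr_right fun hα => ?_
        rw [hiff _ (hrep T) _ hα, hiff _ (hrep S) _ hα, hA1 _ (hrep T) _ (hrep S) hrel]
      · exact fun h => absurd hS h
    have hcomp : (fun S : OA => χ (rep S)) =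
        (LinearMap.funLeft ℂ ℂ c') ∘ (fun (S : OA) (b : OB) => χ (rep S) (sec b)) := by
      funext S g
      simp [LinearMap.funLeft_apply, hχc _ (hrep S)]
    rw [hcomp] at hli
    exact hli.of_comp _
  · intro φ hφ
    let n : OB → ℂ := fun b => ((Finset.univ.filter fun g => c' g = b).card : ℂ)
    have hn : ∀ b, n b ≠ 0 := fun b => by
      simp only [n, ne_eq, Nat.cast_eq_zero, Finset.card_eq_zero]
      exact Finset.nonempty_iff_ne_empty.1 ⟨sec b, by simp [hsec]⟩
    have hf := hsep (fun g => φ (c' g) / n (c' g))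
      (fun β hβ g hg g' hg' => by rw [hceq' β hβ g hg g' hg'])
      (fun α hα => by
        let S : OA := ⟨{α' ∈ A0 | RelA α α'}, α, hα, rfl⟩
        have hαS : χ α = χ (rep S) := by
          have : rep S ∈ (S : Set A) := by
            rw [hrepS S]
            exact ⟨hrep S, (hiff _ (hrep S) _ (hrep S)).2 rfl⟩
          exact hA1 α hα _ (hrep S) this.2
        rw [hαS, ← hφ S, ← Finset.sum_fiberwise_of_maps_to (t := Finset.univ) (g := c')
          (fun _ _ => Finset.mem_univ _)]
        refine Finset.sum_congr rfl fun b _ => ?_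
        rw [Finset.sum_congr rfl (g := fun _ => χ (rep S) (sec b) * (φ b / n b))]
        · rw [Finset.sum_const, nsmul_eq_mul]
          change n b * _ = _
          field_simp [hn b]
        · intro g hg
          obtain rfl := (Finset.mem_filter.1 hg).2
          rw [hχc _ (hrep S)])
    funext b
    have := congrFun hf (sec b)
    simp only [hsec, Pi.zero_apply, div_eq_zero_iff, hn b, or_false] at this
    exact this

end Counting

section OrbitSums

variable {L : Type} [Group L]

/-- `ψ` is the extension by zero of an irreducible character of the subgroup with underlying
set `H`. -/
def IsIrrOn (H : Set L) (ψ : L → ℂ) : Prop :=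
  (∀ h : L, h ∉ H → ψ h = 0) ∧
  ∃ H₀ : Subgroup L, (H₀ : Set L) = H ∧
    ∃ W : FDRep ℂ ↥H₀, CategoryTheory.Simple W ∧ ∀ h : ↥H₀, ψ ↑h = W.character h

/-- `θ` is the extension by zero of the sum of an `S`-orbit of irreducible characters of the
subgroup with underlying set `H`. -/
def IsOrbitSumOn (H S : Set L) (θ : L → ℂ) : Prop :=
  ∃ Sfin : Finset (L → ℂ),
    (∀ ψ ∈ Sfin, IsIrrOn H ψ) ∧
    (∃ ψ₀ ∈ Sfin, ∀ ψ : L → ℂ, ψ ∈ Sfin ↔ ∃ r ∈ S, ∀ h : L, ψ h = ψ₀ (r * h * r⁻¹)) ∧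
    ∀ h : L, θ h = ∑ ψ ∈ Sfin, ψ h

theorem isIrrOn_coe_iff (H : Subgroup L) (ψ : L → ℂ) :
    IsIrrOn (H : Set L) ψ ↔ (∀ h : L, h ∉ H → ψ h = 0) ∧
      ∃ W : FDRep ℂ ↥H, CategoryTheory.Simple W ∧ ∀ h : ↥H, ψ ↑h = W.character h := by
  refine and_congr_right fun _ => ⟨?_, fun h => ⟨H, rfl, h⟩⟩
  rintro ⟨H₀, hH, h⟩
  obtain rfl := SetLike.coe_injective hH
  exact h

theorem IsIrrOn.exists_natCast {H : Set L} {ψ : L → ℂ} (hψ : IsIrrOn H ψ) :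
    ∃ n : ℕ, 0 < n ∧ ψ 1 = n := by
  obtain ⟨_, H₀, rfl, W, hW, hch⟩ := hψ
  refine ⟨Module.finrank ℂ W, ?_, by rw [← FDRep.char_one, ← hch]; rfl⟩
  by_contra h0
  have hsub : Subsingleton W :=
    Module.finrank_zero_iff.1 (Nat.eq_zero_of_not_pos h0)
  refine CategoryTheory.id_nonzero W ?_
  ext x
  exact Subsingleton.elim (α := W) _ _

theorem IsOrbitSumOn.eq_zero_of_notMem {H S : Set L} {θ : L → ℂ} (hθ : IsOrbitSumOn H S θ)
    {h : L} (hh : h ∉ H) : θ h = 0 := by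
  obtain ⟨Sfin, hirr, _, hsum⟩ := hθ
  rw [hsum]
  exact Finset.sum_eq_zero fun ψ hψ => (hirr ψ hψ).1 h hh

theorem IsOrbitSumOn.apply_one_ne_zero {H S : Set L} {θ : L → ℂ} (hθ : IsOrbitSumOn H S θ) :
    θ 1 ≠ 0 := by
  obtain ⟨Sfin, hirr, ⟨ψ₀, hψ₀, _⟩, hsum⟩ := hθ
  choose! n hn hψn using fun ψ hψ => (hirr ψ hψ).exists_natCast
  rw [hsum, Finset.sum_congr rfl hψn, ← Nat.cast_sum, Nat.cast_ne_zero]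
  exact (Finset.sum_pos hn ⟨ψ₀, hψ₀⟩).ne'

variable [Fintype L]

theorem Subgroup.sum_eq_sum_of_support {H : Subgroup L} {f : L → ℂ}
    (hf : ∀ h, h ∉ H → f h = 0) : ∑ h : L, f h = ∑ h : H, f h := by
  rw [← Finset.sum_subtype (Finset.univ.filter (· ∈ H)) (by simp) f]
  refine (Finset.sum_subset (Finset.subset_univ _) fun h _ hh => hf h ?_).symm
  simpa using hh

theorem IsIrrOn.conj {H H' : Subgroup L} {ψ : L → ℂ} (hψ : IsIrrOn (H : Set L) ψ) (t : L)
    (ht : ∀ h, h ∈ H' ↔ t * h * t⁻¹ ∈ H) :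
    IsIrrOn (H' : Set L) fun h => ψ (t * h * t⁻¹) := by
  rw [isIrrOn_coe_iff] at hψ ⊢
  obtain ⟨h0, W, hW, hch⟩ := hψ
  refine ⟨fun h hh => h0 _ (by rwa [← ht]), ?_⟩
  let e : H' ≃* H :=
    { toFun := fun h => ⟨t * h * t⁻¹, (ht h).1 h.2⟩
      invFun := fun h => ⟨t⁻¹ * h * t, (ht _).2 (by simp [mul_assoc])⟩
      left_inv := fun h => Subtype.ext (by simp [mul_assoc])
      right_inv := fun h => Subtype.ext (by simp [mul_assoc])
      map_mul' := fun h k => Subtype.ext (by simp [mul_assoc]) }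
  have hc : ∀ h, (FDRep.of (W.ρ.comp e.toMonoidHom)).character h = W.character (e h) := fun h => rfl
  refine ⟨FDRep.of (W.ρ.comp e.toMonoidHom), ?_, fun h => ?_⟩
  · rw [FDRep.simple_iff_char_is_norm_one] at hW ⊢
    rw [Nat.card_congr e.toEquiv, ← hW]
    exact Fintype.sum_equiv e.toEquiv _ _ fun h => by
      rw [hc, hc, map_inv]
      rfl
  · rw [hc, ← hch]
    rfl

theorem IsIrrOn.sum_mul_conj_eq_zero {H : Subgroup L} {ψ ψ' : L → ℂ}
    (hψ : IsIrrOn (H : Set L) ψ) (hψ' : IsIrrOn (H : Set L) ψ') (hne : ψ ≠ ψ') :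
    ∑ h : L, ψ h * (starRingEnd ℂ) (ψ' h) = 0 := by
  rw [isIrrOn_coe_iff] at hψ hψ'
  obtain ⟨h0, W, hW, hch⟩ := hψ
  obtain ⟨h0', W', hW', hch'⟩ := hψ'
  have := invertibleOfNonzero (NeZero.ne (Nat.card H : ℂ))
  rw [Subgroup.sum_eq_sum_of_support (H := H) fun h hh => by rw [h0 h hh, zero_mul]]
  simp only [hch, hch', FDRep.conj_character]
  have horth := FDRep.char_orthonormal W W'
  rw [if_neg, mul_eq_zero] at horth
  · exact horth.resolve_left (inv_ne_zero (NeZero.ne _))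
  · rintro ⟨i⟩
    refine hne (funext fun h => ?_)
    by_cases hh : h ∈ H
    · rw [hch ⟨h, hh⟩, hch' ⟨h, hh⟩, FDRep.char_iso i]
    · rw [h0 h hh, h0' h hh]

theorem eq_zero_of_forall_isIrrOn {H : Subgroup L} {φ : L → ℂ} (h0 : ∀ h, h ∉ H → φ h = 0)
    (hcl : ∀ h ∈ H, ∀ k, φ (h * k * h⁻¹) = φ k)
    (horth : ∀ ψ, IsIrrOn (H : Set L) ψ → ∑ k, ψ k * φ k = 0) : φ = 0 := by
  have hres : (fun h : H => φ h) = 0 := by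
    refine eq_zero_of_forall_sum_mul_character_eq_zero _ (fun g h => ?_) fun W hW => ?_
    · simpa using hcl h h.2 g
    · let ψ : L → ℂ := fun h => if hh : h ∈ H then W.character ⟨h, hh⟩ else 0
      have hψ := horth ψ ((isIrrOn_coe_iff H ψ).2
        ⟨fun h hh => by simp [ψ, hh], W, hW, fun h => by simp [ψ]⟩)
      rw [Subgroup.sum_eq_sum_of_support (H := H) fun h hh => by rw [h0 h hh, mul_zero]] at hψ
      simpa [ψ, mul_comm] using hψ
  funext h
  by_cases hh : h ∈ H
  · exact congrFun hres ⟨h, hh⟩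
  · exact h0 h hh

theorem IsOrbitSumOn.sum_mul_conj_eq_zero {H S : Subgroup L} {θ θ' : L → ℂ}
    (hθ : IsOrbitSumOn (H : Set L) (S : Set L) θ) (hθ' : IsOrbitSumOn (H : Set L) (S : Set L) θ')
    (hne : θ ≠ θ') : ∑ h : L, θ h * (starRingEnd ℂ) (θ' h) = 0 := by
  obtain ⟨A, hA, ⟨a, ha, hAa⟩, hsum⟩ := hθ
  obtain ⟨A', hA', ⟨a', ha', hAa'⟩, hsum'⟩ := hθ'
  simp only [hsum, hsum', map_sum, Finset.sum_mul_sum]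
  rw [Finset.sum_comm]
  refine Finset.sum_eq_zero fun ψ hψ => ?_
  rw [Finset.sum_comm]
  refine Finset.sum_eq_zero fun ψ' hψ' => ?_
  refine (hA ψ hψ).sum_mul_conj_eq_zero (hA' ψ' hψ') ?_
  rintro rfl
  obtain ⟨r, hr, hψr⟩ := (hAa ψ).1 hψ
  obtain ⟨s, hs, hψs⟩ := (hAa' ψ).1 hψ'
  refine hne (funext fun h => ?_)
  rw [hsum, hsum']
  refine Finset.sum_congr (Finset.ext fun η => ?_) fun _ _ => rfl
  rw [hAa, hAa']
  have key : ∀ (x y : L → ℂ) (p q : L), (∀ h, ψ h = x (p * h * p⁻¹)) →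
      (∀ h, ψ h = y (q * h * q⁻¹)) → ∀ u, (∀ h, η h = x (u * h * u⁻¹)) →
        ∀ h, η h = y ((q * p⁻¹ * u) * h * (q * p⁻¹ * u)⁻¹) := by
    intro x y p q hx hy u hu h
    have h1 := hx (p⁻¹ * (u * h * u⁻¹) * p)
    have h2 := hy (p⁻¹ * (u * h * u⁻¹) * p)
    simp only [mul_assoc, mul_inv_cancel_left, mul_inv_cancel, mul_one, mul_inv_rev, inv_inv]
      at h1 h2 ⊢
    rw [hu h, ← h2, h1, mul_assoc]
  constructor
  · rintro ⟨u, hu, h⟩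
    exact ⟨s * r⁻¹ * u, S.mul_mem (S.mul_mem hs (S.inv_mem hr)) hu, key a a' r s hψr hψs u h⟩
  · rintro ⟨u, hu, h⟩
    exact ⟨r * s⁻¹ * u, S.mul_mem (S.mul_mem hr (S.inv_mem hs)) hu, key a' a s r hψs hψr u h⟩

theorem IsOrbitSumOn.conj {H H' S S' : Subgroup L} {θ : L → ℂ}
    (hθ : IsOrbitSumOn (H : Set L) (S : Set L) θ) (t : L)
    (ht : ∀ h, h ∈ H' ↔ t * h * t⁻¹ ∈ H) (htS : ∀ h, h ∈ S' ↔ t * h * t⁻¹ ∈ S) :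
    IsOrbitSumOn (H' : Set L) (S' : Set L) fun h => θ (t * h * t⁻¹) := by
  obtain ⟨A, hA, ⟨a, ha, hAa⟩, hsum⟩ := hθ
  have hinj : Function.Injective fun (ψ : L → ℂ) (h : L) => ψ (t * h * t⁻¹) := fun ψ ψ' h =>
    funext fun k => by simpa [mul_assoc] using congrFun h (t⁻¹ * k * t)
  refine ⟨A.image fun ψ h => ψ (t * h * t⁻¹), ?_, ⟨fun h => a (t * h * t⁻¹), ?_, ?_⟩, ?_⟩
  · simp only [Finset.mem_image, forall_exists_index, and_imp]
    rintro _ ψ hψ rfl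
    exact (hA ψ hψ).conj t ht
  · exact Finset.mem_image_of_mem _ ha
  · intro η
    simp only [Finset.mem_image]
    constructor
    · rintro ⟨ψ, hψ, rfl⟩
      obtain ⟨r, hr, h⟩ := (hAa ψ).1 hψ
      refine ⟨t⁻¹ * r * t, ?_, fun k => ?_⟩
      · rw [SetLike.mem_coe, htS]
        simpa [mul_assoc] using hr
      · simp [h, mul_assoc]
    · rintro ⟨r, hr, h⟩
      refine ⟨fun k => η (t⁻¹ * k * t), (hAa _).2 ⟨t * r * t⁻¹, (htS r).1 hr, fun k => ?_⟩, ?_⟩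
      · rw [h]
        simp [mul_assoc]
      · funext k
        simp [mul_assoc]
  · intro h
    rw [Finset.sum_image hinj.injOn]
    exact hsum _

theorem eq_zero_of_forall_isOrbitSumOn {H S : Subgroup L} (hHS : H ≤ S)
    (hnorm : ∀ s ∈ S, ∀ h, h ∈ H ↔ s * h * s⁻¹ ∈ H) {φ : L → ℂ} (h0 : ∀ h, h ∉ H → φ h = 0)
    (hcl : ∀ s ∈ S, ∀ k, φ (s * k * s⁻¹) = φ k)
    (horth : ∀ θ, IsOrbitSumOn (H : Set L) (S : Set L) θ → ∑ k, θ k * φ k = 0) : φ = 0 := by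
  refine eq_zero_of_forall_isIrrOn h0 (fun h hh => hcl h (hHS hh)) fun ψ hψ => ?_
  let A : Finset (L → ℂ) := (Finset.univ : Finset S).image fun s h => ψ (s * h * (s : L)⁻¹)
  have hA : ∀ η, η ∈ A ↔ ∃ r ∈ S, ∀ h : L, η h = ψ (r * h * r⁻¹) := fun η => by
    simp [A, funext_iff, eq_comm]
  have hψA : ψ ∈ A := (hA ψ).2 ⟨1, S.one_mem, fun h => by simp⟩
  have horbit := horth (fun h => ∑ η ∈ A, η h) ⟨A, fun η hη => by
    obtain ⟨r, hr, h⟩ := (hA η).1 hη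
    rw [show η = fun h => ψ (r * h * r⁻¹) from funext h]
    exact hψ.conj r (hnorm r hr), ⟨ψ, hψA, hA⟩, fun h => rfl⟩
  simp only [Finset.sum_mul] at horbit
  rw [Finset.sum_comm, Finset.sum_congr rfl (g := fun _ => ∑ k, ψ k * φ k)] at horbit
  · rw [Finset.sum_const, nsmul_eq_mul, mul_eq_zero] at horbit
    exact horbit.resolve_left (Nat.cast_ne_zero.2 (Finset.card_pos.2 ⟨ψ, hψA⟩).ne')
  · intro η hη
    obtain ⟨r, hr, h⟩ := (hA η).1 hη
    refine Fintype.sum_equiv (MulAut.conj r).toEquiv _ _ fun k => ?_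
    simp [h, hcl r hr]

end OrbitSums

section FiniteFourier

variable {F V : Type} [Field F] [AddCommGroup V] [Module F V] [Fintype V]
  (ε : AddChar F ℂ)

theorem AddChar.sum_linearMap_eq_zero (hε : ε ≠ 1) {φ : V →ₗ[F] F} (hφ : φ ≠ 0) :
    ∑ x, ε (φ x) = 0 := by
  refine (AddChar.sum_eq_zero_iff_ne_zero
    (ψ := ε.compAddMonoidHom φ.toAddMonoidHom)).2 fun h => hε ?_
  ext t
  obtain ⟨x, rfl⟩ := LinearMap.surjective hφ t
  simpa using DFunLike.congr_fun h x

theorem AddChar.sum_mul_conj_dual_eq_zero [Finite F] (hε : ε ≠ 1) {μ ν : Module.Dual F V}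
    (hne : μ ≠ ν) : ∑ x, ε (μ x) * (starRingEnd ℂ) (ε (ν x)) = 0 := by
  rw [← AddChar.sum_linearMap_eq_zero ε hε (sub_ne_zero.2 hne)]
  refine Finset.sum_congr rfl fun x _ => ?_
  rw [← AddChar.map_neg_eq_conj, ← AddChar.map_add_eq_mul, LinearMap.sub_apply, sub_eq_add_neg]

/-- A function on a finite vector space with vanishing Fourier transform is zero. -/
theorem eq_zero_of_fourier_eq_zero [Finite F] (hε : ε ≠ 1) (f : V → ℂ)
    (hf : ∀ μ : Module.Dual F V, ∑ x, f x * ε (μ x) = 0) : f = 0 := by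
  have : Finite (Module.Dual F V) := Finite.of_injective _ DFunLike.coe_injective
  have := Fintype.ofFinite (Module.Dual F V)
  funext y
  have h1 : ∑ μ : Module.Dual F V, ε (μ (-y)) * ∑ x, f x * ε (μ x) = 0 := by simp [hf]
  simp only [Finset.mul_sum] at h1
  rw [Finset.sum_comm, Finset.sum_eq_single y] at h1
  · have h2 : ∀ μ : Module.Dual F V, ε (μ (-y)) * (f y * ε (μ y)) = f y := fun μ => by
      rw [mul_left_comm, ← AddChar.map_add_eq_mul, ← map_add, neg_add_cancel, map_zero,
        AddChar.map_zero_eq_one, mul_one]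
    simp only [h2, Finset.sum_const, nsmul_eq_mul, mul_eq_zero] at h1
    exact h1.resolve_left (Nat.cast_ne_zero.2 Fintype.card_ne_zero)
  · intro x _ hxy
    have h2 : ∀ μ : Module.Dual F V, ε (μ (-y)) * (f x * ε (μ x)) =
        f x * ε (Module.Dual.eval F V (x - y) μ) := fun μ => by
      rw [mul_left_comm, ← AddChar.map_add_eq_mul, ← map_add, Module.Dual.eval_apply]
      congr 3
      abel
    simp only [h2, ← Finset.mul_sum]
    rw [AddChar.sum_linearMap_eq_zero ε hε, mul_zero]
    rw [Ne, Module.eval_apply_eq_zero_iff, sub_eq_zero]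
    exact hxy
  · exact fun h => absurd (Finset.mem_univ y) h

end FiniteFourier

section LinearActions

variable {F V L N : Type} [Field F] [AddCommGroup V] [Module F V] [Group L] [Group N]
  (σ : Representation F L V) (τ : Representation F N V)

/-- The orbit of a functional under the contragredient action. -/
def dualOrbit (l : Module.Dual F V) : Set (Module.Dual F V) :=
  {μ | ∃ n : N, ∀ x, μ x = l (τ n x)}

variable {τ} in
theorem mem_dualOrbit_iff {l μ : Module.Dual F V} :
    μ ∈ dualOrbit τ l ↔ ∃ n : N, ∀ x, μ x = l (τ n x) := Iff.rfl

theorem mem_dualOrbit_self (l : Module.Dual F V) : l ∈ dualOrbit τ l := ⟨1, by simp⟩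

variable {τ} in
theorem dualOrbit_eq_of_mem {l μ : Module.Dual F V} (h : μ ∈ dualOrbit τ l) :
    dualOrbit τ μ = dualOrbit τ l := by
  obtain ⟨n, hn⟩ := h
  ext ν
  constructor
  · rintro ⟨m, hm⟩
    exact ⟨n * m, fun x => by rw [hm, hn, map_mul, Module.End.mul_apply]⟩
  · rintro ⟨m, hm⟩
    refine ⟨n⁻¹ * m, fun x => ?_⟩
    rw [hm, hn, ← Module.End.mul_apply, ← map_mul, mul_inv_cancel_left]

/-- The pointwise stabilizer of the orbit of a functional. -/
def orbitFixer (l : Module.Dual F V) : Subgroup L where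
  carrier := {r | ∀ μ ∈ dualOrbit τ l, ∀ x, μ (σ r⁻¹ x) = μ x}
  mul_mem' {r s} hr hs μ hμ x := by
    rw [mul_inv_rev, map_mul, Module.End.mul_apply, hs μ hμ, hr μ hμ]
  one_mem' μ hμ x := by simp
  inv_mem' {r} hr μ hμ x := by
    rw [← hr μ hμ, ← Module.End.mul_apply, ← map_mul]
    simp

/-- The setwise stabilizer of the orbit of a functional. -/
def orbitStabilizer (l : Module.Dual F V) : Subgroup L where
  carrier := {r | ∀ μ ν : Module.Dual F V,
    (∀ x, ν x = μ (σ r⁻¹ x)) → (μ ∈ dualOrbit τ l ↔ ν ∈ dualOrbit τ l)}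
  mul_mem' {r s} hr hs μ ν h :=
    (hs μ (σ.dual s μ) fun x => rfl).trans (hr _ ν fun x => by
      rw [h, mul_inv_rev, map_mul, Module.End.mul_apply]
      rfl)
  one_mem' μ ν h := by
    have : ν = μ := LinearMap.ext fun x => by simpa using h x
    rw [this]
  inv_mem' {r} hr μ ν h := (hr ν μ fun x => by
    rw [h, ← Module.End.mul_apply, ← map_mul]
    simp).symm

theorem mem_orbitFixer_iff {l : Module.Dual F V} {r : L} :
    r ∈ orbitFixer σ τ l ↔ ∀ μ ∈ dualOrbit τ l, σ.dual r μ = μ :=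
  forall₂_congr fun _ _ => (LinearMap.ext_iff (f := σ.dual r _)).symm

theorem mem_orbitStabilizer_iff {l : Module.Dual F V} {r : L} :
    r ∈ orbitStabilizer σ τ l ↔ ∀ μ, μ ∈ dualOrbit τ l ↔ σ.dual r μ ∈ dualOrbit τ l := by
  constructor
  · exact fun h μ => h μ _ fun x => rfl
  · intro h μ ν hν
    rw [show ν = σ.dual r μ from LinearMap.ext hν]
    exact h μ

variable {σ τ} in
theorem orbitFixer_eq_of_mem {l μ : Module.Dual F V} (h : μ ∈ dualOrbit τ l) :
    orbitFixer σ τ μ = orbitFixer σ τ l := by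
  ext r
  rw [mem_orbitFixer_iff, mem_orbitFixer_iff, dualOrbit_eq_of_mem h]

variable {σ τ} in
theorem orbitStabilizer_eq_of_mem {l μ : Module.Dual F V} (h : μ ∈ dualOrbit τ l) :
    orbitStabilizer σ τ μ = orbitStabilizer σ τ l := by
  ext r
  rw [mem_orbitStabilizer_iff, mem_orbitStabilizer_iff, dualOrbit_eq_of_mem h]

theorem orbitFixer_le_orbitStabilizer (l : Module.Dual F V) :
    orbitFixer σ τ l ≤ orbitStabilizer σ τ l := by
  intro r hr
  rw [mem_orbitStabilizer_iff]
  intro μ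
  constructor
  · intro hμ
    rwa [(mem_orbitFixer_iff σ τ).1 hr μ hμ]
  · intro hμ
    have h := (mem_orbitFixer_iff σ τ).1 (inv_mem hr) _ hμ
    rw [← Module.End.mul_apply, ← map_mul, inv_mul_cancel, map_one, Module.End.one_apply] at h
    rwa [h]

/-- The vectors annihilated by all functionals whose orbit is fixed pointwise by `k`. -/
def fixedAnnihilator (k : L) : Submodule F V where
  carrier := {x | ∀ μ, k ∈ orbitFixer σ τ μ → μ x = 0}
  add_mem' ha hb μ hμ := by rw [map_add, ha μ hμ, hb μ hμ, add_zero]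
  zero_mem' μ hμ := map_zero μ
  smul_mem' c x hx μ hμ := by rw [map_smul, hx μ hμ, smul_zero]

theorem mem_fixedAnnihilator_iff {k : L} {x : V} :
    x ∈ fixedAnnihilator σ τ k ↔ ∀ μ, k ∈ orbitFixer σ τ μ → μ x = 0 := Iff.rfl

theorem mem_fixedAnnihilator_iff_exists {k : L} {x : V} :
    x ∈ fixedAnnihilator σ τ k ↔ ∀ μ : Module.Dual F V,
      (∃ ν, μ ∈ dualOrbit τ ν ∧ ∀ ω ∈ dualOrbit τ ν, ∀ x, ω (σ k⁻¹ x) = ω x) → μ x = 0 := by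
  rw [mem_fixedAnnihilator_iff]
  refine forall_congr' fun μ => imp_congr_left ⟨fun h => ⟨μ, mem_dualOrbit_self τ μ, h⟩, ?_⟩
  rintro ⟨ν, hμ, hν⟩
  rw [orbitFixer_eq_of_mem hμ]
  exact hν

theorem mem_orbitFixer_of_forall_fixedAnnihilator [Module.Finite F V] {k : L} {μ : Module.Dual F V}
    (h : ∀ x ∈ fixedAnnihilator σ τ k, μ x = 0) : k ∈ orbitFixer σ τ μ := by
  have hM : ∀ ν : Module.Dual F V, k ∈ orbitFixer σ τ ν ↔
      ∀ n x, ν (τ n (σ k⁻¹ x)) = ν (τ n x) := fun ν => by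
    constructor
    · exact fun hk n x => hk (ν ∘ₗ τ n) ⟨n, fun _ => rfl⟩ x
    · rintro hk μ ⟨n, hn⟩ x
      rw [hn, hn, hk]
  let M : Submodule F (Module.Dual F V) :=
    { carrier := {ν | k ∈ orbitFixer σ τ ν}
      add_mem' := fun {a b} ha hb => by
        simp only [Set.mem_ofPred_eq, hM] at ha hb ⊢
        intro n x
        rw [LinearMap.add_apply, LinearMap.add_apply, ha, hb]
      zero_mem' := by simp [hM]
      smul_mem' := fun c a ha => by
        simp only [Set.mem_ofPred_eq, hM] at ha ⊢
        intro n x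
        rw [LinearMap.smul_apply, LinearMap.smul_apply, ha] }
  have h1 : μ ∈ M.dualCoannihilator.dualAnnihilator := by
    rw [Submodule.mem_dualAnnihilator]
    intro x hx
    exact h x fun ν hν => (Submodule.mem_dualCoannihilator x).1 hx ν hν
  rw [Subspace.dualCoannihilator_dualAnnihilator_eq] at h1
  exact h1

variable {σ τ} in
theorem smul_mem_fixedAnnihilator {k : L} {x : V} (n : N) (hx : x ∈ fixedAnnihilator σ τ k) :
    τ n x ∈ fixedAnnihilator σ τ k := by
  intro μ hμ
  refine hx (μ ∘ₗ τ n) ?_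
  rwa [orbitFixer_eq_of_mem (l := μ) ⟨n, fun _ => rfl⟩]

variable {σ τ} {κ : L → N ≃ N} (hκ : ∀ r n x, σ r (τ n x) = τ (κ r n) (σ r x))

include hκ

theorem dual_mem_dualOrbit {l μ : Module.Dual F V} (r : L) (h : μ ∈ dualOrbit τ l) :
    σ.dual r μ ∈ dualOrbit τ (σ.dual r l) := by
  obtain ⟨n, hn⟩ := h
  refine ⟨(κ r⁻¹).symm n, fun x => ?_⟩
  change μ (σ r⁻¹ x) = l (σ r⁻¹ (τ _ x))
  rw [hκ, Equiv.apply_symm_apply, hn]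

theorem dual_mem_dualOrbit_iff {l μ : Module.Dual F V} (r : L) :
    σ.dual r μ ∈ dualOrbit τ (σ.dual r l) ↔ μ ∈ dualOrbit τ l := by
  refine ⟨fun h => ?_, dual_mem_dualOrbit hκ r⟩
  have := dual_mem_dualOrbit hκ r⁻¹ h
  rwa [← Module.End.mul_apply, ← Module.End.mul_apply, ← map_mul, inv_mul_cancel, map_one] at this

theorem conj_mem_orbitFixer_dual_iff {l : Module.Dual F V} (t h : L) :
    t * h * t⁻¹ ∈ orbitFixer σ τ (σ.dual t l) ↔ h ∈ orbitFixer σ τ l := by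
  rw [mem_orbitFixer_iff, mem_orbitFixer_iff]
  constructor
  · intro H μ hμ
    have := congrArg (σ.dual t⁻¹) (H _ (dual_mem_dualOrbit hκ t hμ))
    simpa only [← Module.End.mul_apply, ← map_mul, mul_assoc, inv_mul_cancel_left, inv_mul_cancel,
      mul_one, map_one, Module.End.one_apply] using this
  · intro H μ hμ
    have h1 : μ = σ.dual t (σ.dual t⁻¹ μ) := by
      rw [← Module.End.mul_apply, ← map_mul, mul_inv_cancel, map_one, Module.End.one_apply]
    rw [h1, dual_mem_dualOrbit_iff hκ] at hμ
    have := congrArg (σ.dual t) (H _ hμ)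
    simpa only [← Module.End.mul_apply, ← map_mul, mul_assoc, mul_inv_cancel_left, mul_inv_cancel,
      mul_one, map_one, Module.End.one_apply] using this

theorem conj_mem_orbitStabilizer_dual_iff {l : Module.Dual F V} (t h : L) :
    t * h * t⁻¹ ∈ orbitStabilizer σ τ (σ.dual t l) ↔ h ∈ orbitStabilizer σ τ l := by
  rw [mem_orbitStabilizer_iff, mem_orbitStabilizer_iff]
  have h1 : ∀ μ, μ = σ.dual t (σ.dual t⁻¹ μ) := fun μ => by
    rw [← Module.End.mul_apply, ← map_mul, mul_inv_cancel, map_one, Module.End.one_apply]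
  constructor
  · intro H μ
    have := H (σ.dual t μ)
    rw [dual_mem_dualOrbit_iff hκ, ← Module.End.mul_apply, ← map_mul, inv_mul_cancel_right,
      map_mul, Module.End.mul_apply, dual_mem_dualOrbit_iff hκ] at this
    exact this
  · intro H μ
    rw [h1 μ, dual_mem_dualOrbit_iff hκ, H, ← dual_mem_dualOrbit_iff hκ t]
    simp only [← Module.End.mul_apply, ← map_mul, mul_assoc, mul_inv_cancel, mul_one]

theorem mem_orbitFixer_iff_conj {l l' : Module.Dual F V} {t : L}
    (ht : σ.dual t l ∈ dualOrbit τ l') (h : L) :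
    h ∈ orbitFixer σ τ l ↔ t * h * t⁻¹ ∈ orbitFixer σ τ l' := by
  rw [← orbitFixer_eq_of_mem ht, conj_mem_orbitFixer_dual_iff hκ]

theorem mem_orbitStabilizer_iff_conj {l l' : Module.Dual F V} {t : L}
    (ht : σ.dual t l ∈ dualOrbit τ l') (h : L) :
    h ∈ orbitStabilizer σ τ l ↔ t * h * t⁻¹ ∈ orbitStabilizer σ τ l' := by
  rw [← orbitStabilizer_eq_of_mem ht, conj_mem_orbitStabilizer_dual_iff hκ]

theorem map_mem_fixedAnnihilator {k : L} {x : V} (p : L) (hx : x ∈ fixedAnnihilator σ τ k) :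
    σ p x ∈ fixedAnnihilator σ τ (p * k * p⁻¹) := by
  intro μ hμ
  have h1 : μ = σ.dual p (σ.dual p⁻¹ μ) := by
    rw [← Module.End.mul_apply, ← map_mul, mul_inv_cancel, map_one, Module.End.one_apply]
  rw [h1, conj_mem_orbitFixer_dual_iff hκ] at hμ
  simpa [Representation.dual_apply, Module.Dual.transpose_apply] using hx _ hμ

theorem dual_mem_of_comp_eq {l l' : Module.Dual F V} {r s : L} {n m : N}
    (h : l ∘ₗ τ n ∘ₗ σ r = l' ∘ₗ τ m ∘ₗ σ s) : σ.dual (s * r⁻¹) l ∈ dualOrbit τ l' := by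
  have h1 : σ.dual (s * r⁻¹) (l ∘ₗ τ n) = l' ∘ₗ τ m := by
    ext z
    have := LinearMap.congr_fun h (σ s⁻¹ z)
    simpa [Representation.dual_apply, Module.Dual.transpose_apply, ← Module.End.mul_apply,
      ← map_mul] using this
  have h2 := dual_mem_dualOrbit hκ (s * r⁻¹) (l := l) (μ := l ∘ₗ τ n) ⟨n, fun _ => rfl⟩
  rw [h1] at h2
  rw [← dualOrbit_eq_of_mem (l := l') (μ := l' ∘ₗ τ m) ⟨m, fun _ => rfl⟩, dualOrbit_eq_of_mem h2]
  exact mem_dualOrbit_self τ _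

end LinearActions

section SuperCharacters

variable {F V L N : Type} [Field F] [AddCommGroup V] [Module F V] [Group L] [Group N]
  [Fintype N]
  (σ : Representation F L V) (τ : Representation F N V) (ε : AddChar F ℂ)

/-- The sum of the additive characters attached to the orbit of a functional, counted with
multiplicity. -/
def orbitSum (l : Module.Dual F V) (x : V) : ℂ := ∑ n : N, ε (l (τ n x))

theorem orbitSum_smul (l : Module.Dual F V) (n : N) (x : V) :
    orbitSum τ ε l (τ n x) = orbitSum τ ε l x :=
  Fintype.sum_equiv (Equiv.mulRight n) _ _ fun m => by simp

variable {τ} in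
theorem orbitSum_eq_of_mem {l μ : Module.Dual F V} (h : μ ∈ dualOrbit τ l) (x : V) :
    orbitSum τ ε μ x = orbitSum τ ε l x := by
  obtain ⟨n, hn⟩ := h
  exact Fintype.sum_equiv (Equiv.mulLeft n) _ _ fun m => by simp [hn]

variable {σ τ} in
theorem orbitSum_dual {κ : L → N ≃ N} (hκ : ∀ r n x, σ r (τ n x) = τ (κ r n) (σ r x))
    (l : Module.Dual F V) (t : L) (x : V) :
    orbitSum τ ε (σ.dual t l) x = orbitSum τ ε l (σ t⁻¹ x) :=
  Fintype.sum_equiv (κ t⁻¹) _ _ fun n => by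
    rw [← hκ]
    rfl

variable [Fintype L]

/-- The function on `L × V` attached to a class function on `L` and a functional on `V`. -/
def superChar (θ : L → ℂ) (l : Module.Dual F V) (k : L) (x : V) : ℂ :=
  ∑ r : L, θ (r * k * r⁻¹) * orbitSum τ ε l (σ r x)

theorem superChar_one_zero (θ : L → ℂ) (l : Module.Dual F V) :
    superChar σ τ ε θ l 1 0 = Fintype.card L * (θ 1 * Fintype.card N) := by
  simp [superChar, orbitSum]

theorem superChar_conj (θ : L → ℂ) (l : Module.Dual F V) (p k : L) (x : V) :
    superChar σ τ ε θ l (p * k * p⁻¹) (σ p x) = superChar σ τ ε θ l k x :=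
  Fintype.sum_equiv (Equiv.mulRight p) _ _ fun r => by simp [mul_assoc]

variable {σ τ} in
theorem superChar_add {θ : L → ℂ} {l : Module.Dual F V} {k : L} {j : V}
    (hθ : ∀ h, h ∉ orbitFixer σ τ l → θ h = 0)
    {κ : L → N ≃ N} (hκ : ∀ r n x, σ r (τ n x) = τ (κ r n) (σ r x))
    (hj : j ∈ fixedAnnihilator σ τ k) (x : V) :
    superChar σ τ ε θ l k (x + j) = superChar σ τ ε θ l k x := by
  refine Finset.sum_congr rfl fun r _ => ?_
  by_cases hr : r * k * r⁻¹ ∈ orbitFixer σ τ l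
  · congr 1
    refine Finset.sum_congr rfl fun n _ => ?_
    rw [map_add, map_add, map_add,
      smul_mem_fixedAnnihilator n (map_mem_fixedAnnihilator hκ r hj) l hr,
      add_zero]
  · rw [hθ _ hr, zero_mul, zero_mul]

variable {σ τ} {κ : L → N ≃ N} (hκ : ∀ r n x, σ r (τ n x) = τ (κ r n) (σ r x))

include hκ

theorem superChar_smul (θ : L → ℂ) (l : Module.Dual F V) (k : L) (n : N) (x : V) :
    superChar σ τ ε θ l k (τ n x) = superChar σ τ ε θ l k x :=
  Finset.sum_congr rfl fun r _ => by rw [hκ, orbitSum_smul]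

theorem superChar_eq_of_dual_mem {θ θ' : L → ℂ} {l l' : Module.Dual F V} {t : L}
    (ht : σ.dual t l ∈ dualOrbit τ l') (hθ : ∀ h, θ' h = θ (t⁻¹ * h * t)) (k : L) (x : V) :
    superChar σ τ ε θ l k x = superChar σ τ ε θ' l' k x := by
  refine Fintype.sum_equiv (Equiv.mulLeft t) _ _ fun r => ?_
  rw [← orbitSum_eq_of_mem ε ht, orbitSum_dual ε hκ, hθ]
  simp [mul_assoc, ← Module.End.mul_apply, ← map_mul]

theorem sum_superChar_mul_conj_eq_zero [Finite F] [Fintype V] (hε : ε ≠ 1) {θ θ' : L → ℂ}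
    {l l' : Module.Dual F V}
    (hθ : IsOrbitSumOn (orbitFixer σ τ l) (orbitStabilizer σ τ l : Set L) θ)
    (hθ' : IsOrbitSumOn (orbitFixer σ τ l') (orbitStabilizer σ τ l' : Set L) θ')
    (hne : ¬ ∃ t, σ.dual t l ∈ dualOrbit τ l' ∧ ∀ h, θ' h = θ (t⁻¹ * h * t)) :
    ∑ k, ∑ x, superChar σ τ ε θ l k x * (starRingEnd ℂ) (superChar σ τ ε θ' l' k x) = 0 := by
  have hrs : ∀ r s : L, (∑ k, θ (r * k * r⁻¹) * (starRingEnd ℂ) (θ' (s * k * s⁻¹))) *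
      ∑ x, orbitSum τ ε l (σ r x) * (starRingEnd ℂ) (orbitSum τ ε l' (σ s x)) = 0 := by
    intro r s
    by_cases hnm : ∃ n m, l ∘ₗ τ n ∘ₗ σ r = l' ∘ₗ τ m ∘ₗ σ s
    · obtain ⟨n, m, h⟩ := hnm
      have ht := dual_mem_of_comp_eq hκ h
      have hc := hθ'.conj (s * r⁻¹) (mem_orbitFixer_iff_conj hκ ht)
        (mem_orbitStabilizer_iff_conj hκ ht)
      have hne' : θ ≠ fun h => θ' (s * r⁻¹ * h * (s * r⁻¹)⁻¹) := by
        intro h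
        refine hne ⟨_, ht, fun h' => ?_⟩
        rw [h]
        simp [mul_assoc]
      refine mul_eq_zero_of_left ?_ _
      rw [← hθ.sum_mul_conj_eq_zero hc hne']
      exact Fintype.sum_equiv (MulAut.conj r).toEquiv _ _ fun k => by simp [mul_assoc]
    · push Not at hnm
      refine mul_eq_zero_of_right _ ?_
      simp only [orbitSum, map_sum, Finset.sum_mul_sum]
      rw [Finset.sum_comm]
      refine Finset.sum_eq_zero fun n _ => ?_
      rw [Finset.sum_comm]
      exact Finset.sum_eq_zero fun m _ => AddChar.sum_mul_conj_dual_eq_zero ε hε (hnm n m)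
  calc _ = ∑ k, ∑ x, ∑ r, ∑ s, (θ (r * k * r⁻¹) * (starRingEnd ℂ) (θ' (s * k * s⁻¹))) *
        (orbitSum τ ε l (σ r x) * (starRingEnd ℂ) (orbitSum τ ε l' (σ s x))) := by
        refine Finset.sum_congr rfl fun k _ => Finset.sum_congr rfl fun x _ => ?_
        simp only [superChar, map_sum, Finset.sum_mul_sum, map_mul]
        exact Finset.sum_congr rfl fun r _ => Finset.sum_congr rfl fun s _ => by ring
    _ = ∑ k, ∑ r, ∑ s, ∑ x, (θ (r * k * r⁻¹) * (starRingEnd ℂ) (θ' (s * k * s⁻¹))) *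
        (orbitSum τ ε l (σ r x) * (starRingEnd ℂ) (orbitSum τ ε l' (σ s x))) := by
        refine Finset.sum_congr rfl fun k _ => ?_
        rw [Finset.sum_comm]
        exact Finset.sum_congr rfl fun r _ => Finset.sum_comm
    _ = ∑ r, ∑ s, ∑ k, ∑ x, (θ (r * k * r⁻¹) * (starRingEnd ℂ) (θ' (s * k * s⁻¹))) *
        (orbitSum τ ε l (σ r x) * (starRingEnd ℂ) (orbitSum τ ε l' (σ s x))) := by
        rw [Finset.sum_comm]
        exact Finset.sum_congr rfl fun r _ => Finset.sum_comm
    _ = 0 := Finset.sum_eq_zero fun r _ => Finset.sum_eq_zero fun s _ => by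
        rw [← hrs r s, Finset.sum_mul_sum]

theorem eq_zero_of_forall_superChar [Finite F] [Fintype V] (hε : ε ≠ 1)
    {R : Set (Module.Dual F V)} (hR : ∀ μ, ∃ l ∈ R, μ ∈ dualOrbit τ l) (f : L → V → ℂ)
    (hconj : ∀ p k x, f (p * k * p⁻¹) (σ p x) = f k x)
    (hsmul : ∀ k n x, f k (τ n x) = f k x)
    (hadd : ∀ k x, ∀ j ∈ fixedAnnihilator σ τ k, f k (x + j) = f k x)
    (hf : ∀ l ∈ R, ∀ θ, IsOrbitSumOn (orbitFixer σ τ l) (orbitStabilizer σ τ l : Set L) θ →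
      ∑ k, ∑ x, superChar σ τ ε θ l k x * f k x = 0) (k : L) (x : V) : f k x = 0 := by
  have : Module.Finite F V := Module.Finite.of_finite
  set c : L → Module.Dual F V → ℂ := fun k μ => ∑ x, f k x * ε (μ x) with hc
  have hbij : ∀ g : L, Function.Bijective (σ g) := fun g =>
    Function.bijective_iff_has_inverse.2 ⟨σ g⁻¹, fun x => by simp, fun x => by simp⟩
  have hbij' : ∀ g : N, Function.Bijective (τ g) := fun g =>
    Function.bijective_iff_has_inverse.2 ⟨τ g⁻¹, fun x => by simp, fun x => by simp⟩
  have hc0 : ∀ k μ, k ∉ orbitFixer σ τ μ → c k μ = 0 := by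
    intro k μ hk
    have hex : ∃ j ∈ fixedAnnihilator σ τ k, ε (μ j) ≠ 1 := by
      by_contra! hcon
      refine hk (mem_orbitFixer_of_forall_fixedAnnihilator σ τ fun x hx => ?_)
      by_contra h0
      refine hε ?_
      ext t
      have := hcon ((t / μ x) • x) (Submodule.smul_mem _ _ hx)
      rwa [map_smul, smul_eq_mul, div_mul_cancel₀ _ h0] at this
    obtain ⟨j, hj, hj1⟩ := hex
    have h1 : c k μ = c k μ * ε (μ j) := by
      rw [hc, Finset.sum_mul]
      refine (Fintype.sum_equiv (Equiv.addRight j) _ _ fun x => ?_).symm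
      rw [Equiv.coe_addRight, hadd k x j hj, map_add, AddChar.map_add_eq_mul, mul_assoc]
    by_contra h0
    exact hj1 ((mul_eq_left₀ h0).1 h1.symm)
  have hcorb : ∀ k l μ, μ ∈ dualOrbit τ l → c k μ = c k l := by
    rintro k l μ ⟨n, hn⟩
    refine (hbij' n).sum_comp (fun y => f k y * ε (l y)) |>.symm.trans ?_ |>.symm
    exact Finset.sum_congr rfl fun x _ => by rw [hsmul, hn]
  have hcconj : ∀ p k μ, c (p * k * p⁻¹) (σ.dual p μ) = c k μ := by
    intro p k μ
    refine ((hbij p).sum_comp (fun y => f (p * k * p⁻¹) y * ε (σ.dual p μ y))).symm.trans ?_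
    refine Finset.sum_congr rfl fun x _ => ?_
    rw [hconj]
    simp [Representation.dual_apply, Module.Dual.transpose_apply]
  have hpair : ∀ θ l, ∑ k, ∑ x, superChar σ τ ε θ l k x * f k x =
      (Fintype.card L * Fintype.card N : ℂ) * ∑ k, θ k * c k l := by
    intro θ l
    have h1 : ∀ r, ∑ k, ∑ x, θ (r * k * r⁻¹) * orbitSum τ ε l (σ r x) * f k x =
        ∑ k, ∑ x, θ k * orbitSum τ ε l x * f k x := by
      intro r
      refine Fintype.sum_equiv (MulAut.conj r).toEquiv _ _ fun k => ?_
      refine Eq.trans ?_ ((hbij r).sum_comp fun x =>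
        θ (r * k * r⁻¹) * orbitSum τ ε l x * f (r * k * r⁻¹) x)
      exact Finset.sum_congr rfl fun x _ => by rw [hconj]
    have h2 : ∀ k, ∑ x, orbitSum τ ε l x * f k x = Fintype.card N * c k l := by
      intro k
      simp only [orbitSum, Finset.sum_mul]
      rw [Finset.sum_comm]
      have h3 : ∀ n, ∑ x, ε (l (τ n x)) * f k x = c k l := fun n => by
        rw [← hcorb k l (l ∘ₗ τ n) ⟨n, fun _ => rfl⟩]
        exact Finset.sum_congr rfl fun x _ => mul_comm _ _
      simp [h3]
    calc _ = ∑ r, ∑ k, ∑ x, θ (r * k * r⁻¹) * orbitSum τ ε l (σ r x) * f k x := by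
          simp only [superChar, Finset.sum_mul]
          rw [Finset.sum_comm (s := (Finset.univ : Finset L)) (t := (Finset.univ : Finset L))]
          exact Finset.sum_congr rfl fun k _ => Finset.sum_comm
      _ = _ := by
          simp only [h1]
          simp only [Finset.sum_const, nsmul_eq_mul, Finset.card_univ, mul_assoc,
            ← Finset.mul_sum, h2]
          congr 1
          rw [Finset.mul_sum]
          exact Finset.sum_congr rfl fun k _ => by ring
  have hzero : ∀ l ∈ R, (fun k => c k l) = 0 := by
    intro l hl
    refine eq_zero_of_forall_isOrbitSumOn (orbitFixer_le_orbitStabilizer σ τ l) ?_ (hc0 · l) ?_ ?_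
    · exact fun s hs => mem_orbitFixer_iff_conj hκ
        (((mem_orbitStabilizer_iff σ τ).1 hs l).1 (mem_dualOrbit_self τ l))
    · intro s hs k
      rw [← hcorb _ _ _ (((mem_orbitStabilizer_iff σ τ).1 hs l).1 (mem_dualOrbit_self τ l)),
        hcconj]
    · intro θ hθ
      have := hf l hl θ hθ
      rw [hpair] at this
      exact (mul_eq_zero.1 this).resolve_left (mul_ne_zero (Nat.cast_ne_zero.2 Fintype.card_ne_zero)
        (Nat.cast_ne_zero.2 Fintype.card_ne_zero))
  refine congrFun (eq_zero_of_fourier_eq_zero ε hε (f k) fun μ => ?_) x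
  obtain ⟨l, hl, hμ⟩ := hR μ
  exact (hcorb k l μ hμ).trans (congrFun (hzero l hl) k)

end SuperCharacters

section Blocks

variable {F V L N : Type} [Field F] [AddCommGroup V] [Module F V] [Group L] [Group N]
  (σ : Representation F L V) (τ : Representation F N V)

/-- The preimage in `V` of an `N`-orbit in the quotient of `V` by the fixed annihilator of `k`. -/
def orbitBlock (k : L) (x₀ : V) : Set V :=
  {y | ∃ n, y - τ n x₀ ∈ fixedAnnihilator σ τ k}

theorem mem_orbitBlock_self (k : L) (x : V) : x ∈ orbitBlock σ τ k x :=
  ⟨1, by simp⟩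

variable {σ τ} in
theorem orbitBlock_eq_of_mem {k : L} {x y : V} (h : y ∈ orbitBlock σ τ k x) :
    orbitBlock σ τ k y = orbitBlock σ τ k x := by
  obtain ⟨n, hn⟩ := h
  ext z
  constructor
  · rintro ⟨m, hm⟩
    refine ⟨m * n, ?_⟩
    have := add_mem hm (smul_mem_fixedAnnihilator m hn)
    rwa [map_sub, sub_add_sub_cancel, ← Module.End.mul_apply, ← map_mul] at this
  · rintro ⟨m, hm⟩
    refine ⟨m * n⁻¹, ?_⟩
    have := sub_mem hm (smul_mem_fixedAnnihilator (m * n⁻¹) hn)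
    rwa [map_sub, ← Module.End.mul_apply, ← map_mul, inv_mul_cancel_right, sub_sub_sub_cancel_right]
      at this

theorem orbitBlock_one_zero : orbitBlock σ τ (1 : L) 0 = {0} := by
  ext y
  simp only [orbitBlock, map_zero, sub_zero, Set.mem_ofPred_eq, exists_const,
    Set.mem_singleton_iff, mem_fixedAnnihilator_iff, one_mem, true_imp_iff]
  exact Module.forall_dual_apply_eq_zero_iff F y

variable {σ τ} {κ : L → N ≃ N} (hκ : ∀ r n x, σ r (τ n x) = τ (κ r n) (σ r x))

include hκ

theorem map_mem_orbitBlock {k : L} {x y : V} (p : L) (h : y ∈ orbitBlock σ τ k x) :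
    σ p y ∈ orbitBlock σ τ (p * k * p⁻¹) (σ p x) := by
  obtain ⟨n, hn⟩ := h
  refine ⟨κ p n, ?_⟩
  rw [← hκ, ← map_sub]
  exact map_mem_fixedAnnihilator hκ p hn

theorem image_orbitBlock (k p : L) (x : V) :
    σ p '' orbitBlock σ τ k x = orbitBlock σ τ (p * k * p⁻¹) (σ p x) := by
  ext y
  constructor
  · rintro ⟨z, hz, rfl⟩
    exact map_mem_orbitBlock hκ p hz
  · intro hy
    refine ⟨σ p⁻¹ y, ?_, by simp⟩
    simpa [mul_assoc] using map_mem_orbitBlock hκ p⁻¹ hy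

theorem superChar_eq_of_mem_orbitBlock [Fintype L] [Fintype N] (ε : AddChar F ℂ) {θ : L → ℂ}
    {l : Module.Dual F V} (hθ : ∀ h, h ∉ orbitFixer σ τ l → θ h = 0) {k : L} {x y : V}
    (h : y ∈ orbitBlock σ τ k x) : superChar σ τ ε θ l k y = superChar σ τ ε θ l k x := by
  obtain ⟨n, hn⟩ := h
  rw [← superChar_smul ε hκ θ l k n x, ← superChar_add ε hθ hκ hn (τ n x), add_sub_cancel]

/-- The supercharacter theory on a finite set parametrized by `L × V`. -/
theorem superChar_theory [Fintype L] [Fintype N] [Fintype V] [Finite F] {G : Type} [Fintype G]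
    (ε : AddChar F ℂ) (hε : ε ≠ 1) (e : L × V → G) (he : Function.Bijective e)
    (χ : (L → ℂ) → Module.Dual F V → G → ℂ) (c : Module.Dual F V → ℂ) (hc : ∀ l, c l ≠ 0)
    (hcc : ∀ l l' t, σ.dual t l ∈ dualOrbit τ l' → c l = c l')
    (hχ : ∀ θ l, (∀ h, h ∉ orbitFixer σ τ l → θ h = 0) →
      ∀ k x, χ θ l (e (k, x)) = c l * superChar σ τ ε θ l k x)
    (R : Set (Module.Dual F V)) (hR : ∀ μ, ∃ l ∈ R, μ ∈ dualOrbit τ l)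
    (A0 : Set ((L → ℂ) × Module.Dual F V)) (hA0 : ∀ α, α ∈ A0 ↔ α.2 ∈ R ∧
      IsOrbitSumOn (orbitFixer σ τ α.2) (orbitStabilizer σ τ α.2 : Set L) α.1)
    (B0 : Set (L × Set V)) (hB0 : ∀ β, β ∈ B0 ↔ ∃ x, β.2 = orbitBlock σ τ β.1 x)
    (K : L × Set V → Set G)
    (hK : ∀ β g, g ∈ K β ↔ ∃ p, ∃ x ∈ β.2, g = e (p * β.1 * p⁻¹, σ p x))
    (RelA : (L → ℂ) × Module.Dual F V → (L → ℂ) × Module.Dual F V → Prop)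
    (hRelA : ∀ α α', RelA α α' ↔
      ∃ t, σ.dual t α.2 ∈ dualOrbit τ α'.2 ∧ ∀ h, α'.1 h = α.1 (t⁻¹ * h * t))
    (RelB : L × Set V → L × Set V → Prop)
    (hRelB : ∀ β β', RelB β β' ↔ ∃ r, β'.1 = r * β.1 * r⁻¹ ∧ β'.2 = σ r '' β.2) :
    (∀ α ∈ A0, ∀ α' ∈ A0, (RelA α α' → χ α.1 α.2 = χ α'.1 α'.2) ∧
      (¬ RelA α α' → ∑ g, χ α.1 α.2 g * (starRingEnd ℂ) (χ α'.1 α'.2 g) = 0)) ∧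
    (∀ g, ∃! S, S ∈ {S | ∃ β ∈ B0, S = {β' ∈ B0 | RelB β β'}} ∧ ∃ β ∈ S, g ∈ K β) ∧
    (∃ β ∈ B0, K β = {e (1, 0)}) ∧
    (∀ α ∈ A0, ∀ β ∈ B0, ∀ g ∈ K β, ∀ g' ∈ K β, χ α.1 α.2 g = χ α.1 α.2 g') ∧
    Nat.card ↥{S | ∃ α ∈ A0, S = {α' ∈ A0 | RelA α α'}} =
      Nat.card ↥{S | ∃ β ∈ B0, S = {β' ∈ B0 | RelB β β'}} := by
  have hsum : ∀ f : G → ℂ, ∑ g, f g = ∑ k, ∑ x, f (e (k, x)) := fun f => by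
    rw [← Fintype.sum_prod_type' (fun k x => f (e (k, x)))]
    exact (he.sum_comp f).symm
  have hsupp : ∀ α ∈ A0, ∀ h, h ∉ orbitFixer σ τ α.2 → α.1 h = 0 := fun α hα h hh =>
    ((hA0 α).1 hα).2.eq_zero_of_notMem hh
  have hA1 : ∀ α ∈ A0, ∀ α' ∈ A0, RelA α α' → χ α.1 α.2 = χ α'.1 α'.2 := by
    intro α hα α' hα' hrel
    obtain ⟨t, ht, hθ⟩ := (hRelA _ _).1 hrel
    funext g
    obtain ⟨⟨k, x⟩, rfl⟩ := he.2 g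
    rw [hχ _ _ (hsupp α hα), hχ _ _ (hsupp α' hα'), hcc _ _ t ht,
      superChar_eq_of_dual_mem ε hκ ht hθ]
  have hA2 : ∀ α ∈ A0, ∀ α' ∈ A0, ¬ RelA α α' →
      ∑ g, χ α.1 α.2 g * (starRingEnd ℂ) (χ α'.1 α'.2 g) = 0 := by
    intro α hα α' hα' hrel
    rw [hRelA] at hrel
    have h0 := sum_superChar_mul_conj_eq_zero ε hκ hε ((hA0 α).1 hα).2 ((hA0 α').1 hα').2 hrel
    rw [hsum, ← mul_zero (c α.2 * (starRingEnd ℂ) (c α'.2)), ← h0]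
    simp only [hχ _ _ (hsupp α hα), hχ _ _ (hsupp α' hα'), map_mul, Finset.mul_sum]
    exact Finset.sum_congr rfl fun k _ => Finset.sum_congr rfl fun x _ => by ring
  have hA3 : ∀ α ∈ A0, χ α.1 α.2 ≠ 0 := by
    intro α hα h0
    have h1 := congrFun h0 (e (1, 0))
    rw [hχ _ _ (hsupp α hα), superChar_one_zero] at h1
    refine mul_ne_zero (hc _) (mul_ne_zero (Nat.cast_ne_zero.2 Fintype.card_ne_zero)
      (mul_ne_zero ?_ (Nat.cast_ne_zero.2 Fintype.card_ne_zero))) h1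
    exact ((hA0 α).1 hα).2.apply_one_ne_zero
  have hKmem : ∀ k x (g : G), g ∈ K (k, orbitBlock σ τ k x) ↔
      ∃ p, ∃ y ∈ orbitBlock σ τ (p * k * p⁻¹) (σ p x), g = e (p * k * p⁻¹, y) := by
    intro k x g
    simp only [hK, ← image_orbitBlock hκ, Set.exists_mem_image]
  have hB0' : ∀ β ∈ B0, ∃ k x, β = (k, orbitBlock σ τ k x) := by
    rintro ⟨k, ω⟩ hβ
    obtain ⟨x, hx⟩ := (hB0 _).1 hβ
    exact ⟨k, x, Prod.ext rfl hx⟩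
  have hB0'' : ∀ k x, (k, orbitBlock σ τ k x) ∈ B0 := fun k x => (hB0 _).2 ⟨x, rfl⟩
  have hB1 : ∀ β ∈ B0, ∀ β' ∈ B0, RelB β β' → K β = K β' := by
    rintro ⟨k, ω⟩ - ⟨k', ω'⟩ - hrel
    obtain ⟨r, hr, hr'⟩ := (hRelB _ _).1 hrel
    dsimp only at hr hr'
    subst hr hr'
    ext g
    simp only [hK, Set.exists_mem_image]
    constructor
    · rintro ⟨p, x, hx, rfl⟩
      exact ⟨p * r⁻¹, x, hx, by simp [mul_assoc]⟩
    · rintro ⟨p, x, hx, rfl⟩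
      exact ⟨p * r, x, hx, by simp [mul_assoc]⟩
  have hB2 : ∀ β ∈ B0, ∀ β' ∈ B0, ∀ g, g ∈ K β → g ∈ K β' → RelB β β' := by
    intro β hβ β' hβ' g hg hg'
    obtain ⟨k, x, rfl⟩ := hB0' β hβ
    obtain ⟨k', x', rfl⟩ := hB0' β' hβ'
    obtain ⟨p, y, hy, rfl⟩ := (hKmem _ _ _).1 hg
    obtain ⟨p', y', hy', h⟩ := (hKmem _ _ _).1 hg'
    obtain ⟨h1, rfl⟩ := Prod.ext_iff.1 (he.1 h)
    dsimp only at h1 hy'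
    refine (hRelB _ _).2 ⟨p'⁻¹ * p, ?_, ?_⟩
    · calc k' = p'⁻¹ * (p' * k' * p'⁻¹) * p' := by group
        _ = _ := by rw [← h1]; group
    · have h2 := orbitBlock_eq_of_mem hy'
      rw [← h1, orbitBlock_eq_of_mem hy, h1, ← image_orbitBlock hκ, ← h1,
        ← image_orbitBlock hκ] at h2
      dsimp only
      rw [map_mul, Module.End.coe_mul, Set.image_comp, h2, ← Set.image_comp, ← Module.End.coe_mul,
        ← map_mul, inv_mul_cancel, map_one]
      simp
  have hB3 : ∀ β ∈ B0, (K β).Nonempty := by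
    intro β hβ
    obtain ⟨k, x, rfl⟩ := hB0' β hβ
    exact ⟨_, (hK _ _).2 ⟨1, x, mem_orbitBlock_self σ τ k x, rfl⟩⟩
  have hB4 : ∀ g, ∃ β ∈ B0, g ∈ K β := by
    intro g
    obtain ⟨⟨k, x⟩, rfl⟩ := he.2 g
    exact ⟨_, hB0'' k x, (hK _ _).2 ⟨1, x, mem_orbitBlock_self σ τ k x, by simp⟩⟩
  have hconst : ∀ α ∈ A0, ∀ β ∈ B0, ∀ g ∈ K β, ∀ g' ∈ K β,
      χ α.1 α.2 g = χ α.1 α.2 g' := by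
    intro α hα β hβ
    obtain ⟨k, x, rfl⟩ := hB0' β hβ
    have h1 : ∀ g ∈ K (k, orbitBlock σ τ k x),
        χ α.1 α.2 g = c α.2 * superChar σ τ ε α.1 α.2 k x := by
      intro g hg
      obtain ⟨p, y, hy, rfl⟩ := (hK _ _).1 hg
      rw [hχ _ _ (hsupp α hα), superChar_conj,
        superChar_eq_of_mem_orbitBlock hκ ε (hsupp α hα) hy]
    intro g hg g' hg'
    rw [h1 g hg, h1 g' hg']
  refine ⟨fun α hα α' hα' => ⟨hA1 α hα α' hα', hA2 α hα α' hα'⟩,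
    existsUnique_cell B0 K RelB hB1 hB2 hB3 hB4, ⟨_, hB0'' 1 0, ?_⟩, hconst,
    card_classes_eq A0 B0 (fun α => χ α.1 α.2) K RelA RelB hA1 hA2 hA3 hB1 hB2 hB3 hB4 hconst ?_⟩
  · ext g
    rw [hKmem]
    simp [orbitBlock_one_zero]
  · intro f hf hf0
    have hmem : ∀ p k x y, y ∈ orbitBlock σ τ k x →
        e (p * k * p⁻¹, σ p y) ∈ K (k, orbitBlock σ τ k x) := fun p k x y hy =>
      (hK _ _).2 ⟨p, y, hy, rfl⟩
    have hmem' : ∀ k x y, y ∈ orbitBlock σ τ k x → e (k, y) ∈ K (k, orbitBlock σ τ k x) :=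
      fun k x y hy => by simpa using hmem 1 k x y hy
    have h0 := eq_zero_of_forall_superChar ε hκ hε hR (fun k x => f (e (k, x)))
      (fun p k x => hf _ (hB0'' k x) _ (hmem p k x x (mem_orbitBlock_self σ τ k x)) _
        (hmem' k x x (mem_orbitBlock_self σ τ k x)))
      (fun k n x => hf _ (hB0'' k x) _ (hmem' k x _ ⟨n, by simp⟩) _
        (hmem' k x x (mem_orbitBlock_self σ τ k x)))
      (fun k x j hj => hf _ (hB0'' k x) _ (hmem' k x _ ⟨1, by simpa using hj⟩) _
        (hmem' k x x (mem_orbitBlock_self σ τ k x)))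
      (fun l hl θ hθ => by
        have hα : (θ, l) ∈ A0 := (hA0 _).2 ⟨hl, hθ⟩
        have h1 := hf0 _ hα
        rw [hsum] at h1
        simp only [hχ θ l (hsupp _ hα), mul_assoc, ← Finset.mul_sum] at h1
        exact (mul_eq_zero.1 h1).resolve_left (hc l))
    funext g
    obtain ⟨⟨k, x⟩, rfl⟩ := he.2 g
    exact h0 k x

end Blocks

section TwoSided

variable {F J : Type} [Field F] [NonUnitalRing J] [Module F J]

variable (F J) in
/-- The two-sided action of the quasiregular elements, `(u, v)` acting by left multiplication by `u`
and right multiplication by `v⁻¹`. -/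
def twoSided [SMulCommClass F J J] [IsScalarTower F J J] :
    Representation F ((PreQuasiregular J)ˣ × (PreQuasiregular J)ˣ) J where
  toFun n :=
    (LinearMap.id + LinearMap.mulRight F (n.2⁻¹ : (PreQuasiregular J)ˣ).val.val) ∘ₗ
      (LinearMap.id + LinearMap.mulLeft F n.1.val.val)
  map_one' := by
    ext x
    simp
  map_mul' m n := by
    ext x
    simp only [Prod.fst_mul, Prod.snd_mul, mul_inv_rev, Units.val_mul, PreQuasiregular.val_mul,
      LinearMap.comp_apply, LinearMap.add_apply, LinearMap.id_apply, LinearMap.mulLeft_apply,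
      LinearMap.mulRight_apply, Module.End.mul_apply, mul_add, add_mul, mul_assoc]
    abel

theorem exists_equiv_twoSided [SMulCommClass F J J] [IsScalarTower F J J]
    (hq : ∀ w : J, ∃ w', w + w' + w * w' = 0 ∧ w' + w + w' * w = 0) :
    ∃ f : J × J ≃ (PreQuasiregular J)ˣ × (PreQuasiregular J)ˣ, ∀ a b x,
      twoSided F J (f (a, b)) x = (x + a * x) + (x + a * x) * b := by
  have hbij : Function.Bijective fun n : (PreQuasiregular J)ˣ × (PreQuasiregular J)ˣ =>
      (n.1.val.val, (n.2⁻¹).val.val) := by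
    have hval : Function.Injective fun u : (PreQuasiregular J)ˣ => u.val.val := fun u v h =>
      Units.ext (PreQuasiregular.equiv.symm.injective h)
    have hsurj : ∀ w : J, ∃ u : (PreQuasiregular J)ˣ, u.val.val = w := fun w => by
      obtain ⟨w', h1, h2⟩ := hq w
      refine ⟨⟨⟨w⟩, ⟨w'⟩, congrArg PreQuasiregular.mk ?_, congrArg PreQuasiregular.mk ?_⟩, rfl⟩
      · simpa [add_comm w w'] using h1
      · simpa [add_comm w w'] using h2
    constructor
    · rintro ⟨u, v⟩ ⟨u', v'⟩ h
      obtain ⟨h1, h2⟩ := Prod.ext_iff.1 h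
      exact Prod.ext (hval h1) (inv_injective (hval h2))
    · rintro ⟨a, b⟩
      obtain ⟨u, rfl⟩ := hsurj a
      obtain ⟨v, rfl⟩ := hsurj b
      exact ⟨(u, v⁻¹), by simp⟩
  refine ⟨(Equiv.ofBijective _ hbij).symm, fun a b x => ?_⟩
  obtain ⟨n, hn⟩ := (Equiv.ofBijective _ hbij).surjective (a, b)
  rw [← hn, Equiv.symm_apply_apply]
  rw [Equiv.ofBijective_apply, Prod.ext_iff] at hn
  obtain ⟨rfl, rfl⟩ := hn
  rfl

variable {L N : Type} [Group L] [Group N] {σ : Representation F L J} {τ : Representation F N J}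
  (hσ : ∀ r x y, σ r (x * y) = σ r x * σ r y) {f : J × J ≃ N}
  (hτ : ∀ a b x, τ (f (a, b)) x = (x + a * x) + (x + a * x) * b)

include hσ hτ in
theorem exists_equiv_intertwining :
    ∃ κ : L → N ≃ N, ∀ r n x, σ r (τ n x) = τ (κ r n) (σ r x) := by
  have hbij : ∀ g : L, Function.Bijective (σ g) := fun g =>
    Function.bijective_iff_has_inverse.2 ⟨σ g⁻¹, fun x => by simp, fun x => by simp⟩
  refine ⟨fun r => f.symm.trans
    (((Equiv.ofBijective _ (hbij r)).prodCongr (Equiv.ofBijective _ (hbij r))).trans f),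
    fun r n x => ?_⟩
  obtain ⟨⟨a, b⟩, rfl⟩ := f.surjective n
  simp [hτ, hσ]

include hτ in
theorem mem_dualOrbit_iff_of_equiv {l μ : Module.Dual F J} :
    μ ∈ dualOrbit τ l ↔ ∃ w z : J, ∀ x, μ x = l ((x + z * x) + (x + z * x) * w) := by
  rw [mem_dualOrbit_iff]
  constructor
  · rintro ⟨n, hn⟩
    obtain ⟨⟨a, b⟩, rfl⟩ := f.surjective n
    exact ⟨b, a, fun x => by rw [hn, hτ]⟩
  · rintro ⟨w, z, h⟩
    exact ⟨f (z, w), fun x => by rw [h, hτ]⟩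

include hτ in
theorem mem_orbitBlock_iff_of_equiv {k : L} {x₀ y : J} :
    y ∈ orbitBlock σ τ k x₀ ↔ ∃ z, (∃ w w' : J, z = (x₀ + w * x₀) + (x₀ + w * x₀) * w') ∧
      y - z ∈ fixedAnnihilator σ τ k := by
  constructor
  · rintro ⟨n, hn⟩
    obtain ⟨⟨a, b⟩, rfl⟩ := f.surjective n
    exact ⟨_, ⟨a, b, rfl⟩, by rwa [hτ] at hn⟩
  · rintro ⟨z, ⟨w, w', rfl⟩, h⟩
    exact ⟨f (w, w'), by rwa [hτ]⟩

include hσ hτ in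
theorem apply_mul_of_mem_orbitFixer {l : Module.Dual F J} {h : L} (hh : h ∈ orbitFixer σ τ l)
    (a q : J) : l (σ h⁻¹ a * q) = l (a * q) := by
  have h1 : ∀ x, l (σ h x) = l x := fun x => by
    simpa using inv_mem hh l (mem_dualOrbit_self τ l) x
  have h2 : ∀ x, l (σ h x + a * σ h x) = l (x + a * x) := fun x => by
    have := inv_mem hh (l ∘ₗ τ (f (a, 0))) ⟨_, fun _ => rfl⟩ x
    simpa [hτ] using this
  have h3 : σ h⁻¹ a * q = σ h⁻¹ (a * σ h q) := by simp [hσ]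
  rw [h3, hh l (mem_dualOrbit_self τ l)]
  have := h2 q
  rwa [map_add, map_add, h1, add_right_inj] at this

theorem apply_of_mem_orbitFixer {l : Module.Dual F J} {h : L} (hh : h ∈ orbitFixer σ τ l)
    (a : J) : l (σ h⁻¹ a) = l a :=
  hh l (mem_dualOrbit_self τ l) a

include hσ hτ in
/-- The right radical has the same cardinality at all functionals in the same class. -/
theorem card_radical_eq {l l' : Module.Dual F J} {t : L} (ht : σ.dual t l ∈ dualOrbit τ l') :
    Nat.card {z : J | ∀ w, l (z * w) = 0} = Nat.card {z : J | ∀ w, l' (z * w) = 0} := by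
  obtain ⟨n, hn⟩ := ht
  obtain ⟨⟨a, b⟩, rfl⟩ := f.surjective n
  have hbij : ∀ g : L, Function.Bijective (σ g) := fun g =>
    Function.bijective_iff_has_inverse.2 ⟨σ g⁻¹, fun x => by simp, fun x => by simp⟩
  have hbij' : ∀ g : N, Function.Bijective (τ g) := fun g =>
    Function.bijective_iff_has_inverse.2 ⟨τ g⁻¹, fun x => by simp, fun x => by simp⟩
  refine Nat.card_congr (((Equiv.ofBijective _ (hbij t)).trans
    (Equiv.ofBijective _ (hbij' (f (a, 0))))).subtypeEquiv fun z => ?_)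
  have hz : ∀ w, l (z * w) = l' ((σ t z + a * σ t z) * (σ t w + σ t w * b)) := fun w => by
    have h1 : l (z * w) = σ.dual t l (σ t (z * w)) := by
      change _ = l (σ t⁻¹ (σ t (z * w)))
      simp
    rw [h1, hn, hτ, hσ]
    simp only [mul_add, add_mul, mul_assoc]
  have hsurj : ∀ y, ∃ w, σ t w + σ t w * b = y := fun y => by
    obtain ⟨v, hv⟩ := (hbij' (f (0, b))).2 y
    obtain ⟨w, rfl⟩ := (hbij t).2 v
    exact ⟨w, by simpa [hτ] using hv⟩
  simp only [Set.mem_ofPred_eq, hz, Equiv.trans_apply, Equiv.ofBijective_apply, hτ, mul_zero,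
    add_zero]
  constructor
  · intro h w
    obtain ⟨v, rfl⟩ := hsurj w
    exact h v
  · exact fun h w => h _

/-- Detecting membership in the right radical by an additive character. -/
theorem ite_radical_eq_sum [SMulCommClass F J J] [Fintype J] {ε : AddChar F ℂ} (hε : ε ≠ 1)
    (l : Module.Dual F J) (z : J) : (if ∀ w, l (z * w) = 0 then ε (l z) else 0) =
      (Fintype.card J : ℂ)⁻¹ * ∑ w, ε (l (z + z * w)) := by
  simp only [map_add, AddChar.map_add_eq_mul, ← Finset.mul_sum]
  split_ifs with h
  · simp only [h, AddChar.map_zero_eq_one, Finset.sum_const, nsmul_eq_mul, mul_one]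
    rw [Finset.card_univ, mul_comm, mul_assoc,
      mul_inv_cancel₀ (Nat.cast_ne_zero.2 Fintype.card_ne_zero), mul_one]
  · have h0 : l ∘ₗ LinearMap.mulLeft F z ≠ 0 := fun h0 => h fun w => LinearMap.congr_fun h0 w
    have := AddChar.sum_linearMap_eq_zero ε hε h0
    simp only [LinearMap.comp_apply, LinearMap.mulLeft_apply] at this
    rw [this, mul_zero, mul_zero]

end TwoSided

section Extension

variable {J G : Type} [NonUnitalRing J] [Group G] {em : J → G}

theorem embedding_zero (hem : ∀ x y : J, em x * em y = em (x + y + x * y)) : em 0 = 1 := by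
  have := hem 0 0
  simpa using this

theorem exists_quasiinverse [Finite J] (hem : ∀ x y : J, em x * em y = em (x + y + x * y))
    (hinj : Function.Injective em) (w : J) :
    ∃ w', w + w' + w * w' = 0 ∧ w' + w + w' * w = 0 := by
  have hsurj : Function.Surjective fun y => w + y + w * y := Finite.surjective_of_injective
    fun y y' h => hinj (mul_left_cancel (a := em w) (by rw [hem, hem]; exact congrArg em h))
  obtain ⟨w', hw'⟩ := hsurj 0
  refine ⟨w', hw', hinj ?_⟩
  rw [← hem, embedding_zero hem]
  refine mul_eq_one_comm.1 ?_
  rw [hem, ← embedding_zero hem]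
  exact congrArg em hw'

variable {F L N : Type} [Field F] [Module F J] [Group L] [Group N]
  {σ : Representation F L J} {τ : Representation F N J}
  (hσ : ∀ r x y, σ r (x * y) = σ r x * σ r y) {f : J × J ≃ N}
  (hτ : ∀ a b x, τ (f (a, b)) x = (x + a * x) + (x + a * x) * b)
  {ρ : L →* G} (hem : ∀ x y : J, em x * em y = em (x + y + x * y))
  (hconj : ∀ h x, ρ h * em x * (ρ h)⁻¹ = em (σ h x))
  {dec : G → L × J} (hdec : ∀ h x, dec (ρ h * em x) = (h, x))
  (hdec' : ∀ g, ρ (dec g).1 * em (dec g).2 = g)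

include hconj in
theorem embedding_mul_map (h : L) (x : J) : em x * ρ h = ρ h * em (σ h⁻¹ x) := by
  rw [← hconj]
  simp [mul_assoc]

include hem hconj hdec hdec' in
theorem dec_mul (g g' : G) : dec (g * g') = ((dec g).1 * (dec g').1,
    σ (dec g').1⁻¹ (dec g).2 + (dec g').2 + σ (dec g').1⁻¹ (dec g).2 * (dec g').2) := by
  rw [← hdec, map_mul, ← hem, mul_assoc, ← mul_assoc (ρ (dec g').1), ← embedding_mul_map hconj,
    mul_assoc, hdec', ← mul_assoc, hdec']

include hem hdec in
theorem dec_one : dec 1 = (1, 0) := by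
  rw [← hdec, map_one, embedding_zero hem, one_mul]

/-- The subgroup of the extension generated by a pointwise stabilizer and a right radical. -/
theorem exists_inertia_subgroup [Finite G] (hσ : ∀ r x y, σ r (x * y) = σ r x * σ r y)
    (hτ : ∀ a b x, τ (f (a, b)) x = (x + a * x) + (x + a * x) * b)
    (hem : ∀ x y : J, em x * em y = em (x + y + x * y))
    (hconj : ∀ h x, ρ h * em x * (ρ h)⁻¹ = em (σ h x))
    (hdec : ∀ h x, dec (ρ h * em x) = (h, x)) (hdec' : ∀ g, ρ (dec g).1 * em (dec g).2 = g)
    (l : Module.Dual F J) :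
    ∃ Q : Subgroup G,
      (∀ g, g ∈ Q ↔ (dec g).1 ∈ orbitFixer σ τ l ∧ ∀ w, l ((dec g).2 * w) = 0) ∧
      ∀ g ∈ Q, ∀ g' ∈ Q, l (dec (g * g')).2 = l (dec g).2 + l (dec g').2 := by
  have key := fun {h} hh => apply_mul_of_mem_orbitFixer (h := h) (l := l) hσ hτ hh
  let S : Submonoid G :=
    { carrier := {g | (dec g).1 ∈ orbitFixer σ τ l ∧ ∀ w, l ((dec g).2 * w) = 0}
      one_mem' := by
        rw [Set.mem_ofPred_eq, dec_one hem hdec]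
        exact ⟨one_mem _, by simp⟩
      mul_mem' := fun {g g'} hg hg' => by
        rw [Set.mem_ofPred_eq, dec_mul hem hconj hdec hdec']
        refine ⟨mul_mem hg.1 hg'.1, fun w => ?_⟩
        simp only [add_mul, mul_assoc, map_add, key hg'.1, hg.2, hg'.2, add_zero] }
  refine ⟨{ S with
    inv_mem' := fun {g} hg => by
      rw [inv_eq_of_mul_eq_one_left (a := g ^ (orderOf g - 1))]
      · exact S.pow_mem hg _
      · rw [← pow_succ, Nat.sub_add_cancel (orderOf_pos g), pow_orderOf_eq_one] },
    fun g => Iff.rfl, fun g hg g' hg' => ?_⟩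
  rw [dec_mul hem hconj hdec hdec', map_add, map_add, key hg'.1, hg.2, add_zero,
    apply_of_mem_orbitFixer hg'.1]

include hσ hτ hem hconj hdec hdec' in
/-- The induced function is a character. -/
theorem exists_character_eq_induced_orbitSum [Fintype G] [Finite L] [Finite J] (ε : AddChar F ℂ)
    (l : Module.Dual F J) (S : Set L) (θ : L → ℂ)
    (hθ : IsOrbitSumOn (orbitFixer σ τ l) S θ) :
    ∃ X : FDRep ℂ G, ∀ g,
      ((Nat.card (orbitFixer σ τ l) * Nat.card {z : J | ∀ w, l (z * w) = 0} : ℕ) : ℂ)⁻¹ *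
        ∑ s : G, (if (dec (s * g * s⁻¹)).1 ∈ orbitFixer σ τ l ∧
            ∀ w, l ((dec (s * g * s⁻¹)).2 * w) = 0 then
          θ (dec (s * g * s⁻¹)).1 * ε (l (dec (s * g * s⁻¹)).2) else 0) = X.character g := by
  obtain ⟨Q, hQ, hQl⟩ := exists_inertia_subgroup hσ hτ hem hconj hdec hdec' l
  have hcard : Nat.card Q =
      Nat.card (orbitFixer σ τ l) * Nat.card {z : J | ∀ w, l (z * w) = 0} := by
    rw [← Nat.card_prod]
    refine Nat.card_congr
      { toFun := fun q => (⟨(dec q).1, ((hQ q).1 q.2).1⟩, ⟨(dec q).2, ((hQ q).1 q.2).2⟩)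
        invFun := fun p => ⟨ρ p.1 * em p.2, (hQ _).2 (by rw [hdec]; exact ⟨p.1.2, p.2.2⟩)⟩
        left_inv := fun q => Subtype.ext (hdec' q)
        right_inv := fun p => by
          ext
          · simp [hdec]
          · simp [hdec] }
  obtain ⟨A, hA, -, hsum⟩ := hθ
  have hψ : ∀ ψ ∈ A, ∃ X : FDRep ℂ G, ∀ g, (Nat.card Q : ℂ)⁻¹ *
      ∑ s : G, (if s * g * s⁻¹ ∈ Q then
        ψ (dec (s * g * s⁻¹)).1 * ε (l (dec (s * g * s⁻¹)).2) else 0) = X.character g := by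
    intro ψ hψA
    obtain ⟨-, W, -, hW⟩ := (isIrrOn_coe_iff _ _).1 (hA ψ hψA)
    let T : Q →* (W →ₗ[ℂ] W) :=
      { toFun := fun q => ε (l (dec q).2) • W.ρ ⟨(dec q).1, ((hQ q).1 q.2).1⟩
        map_one' := by
          have h1 : (⟨(dec (1 : Q)).1, ((hQ _).1 (1 : Q).2).1⟩ : orbitFixer σ τ l) = 1 :=
            Subtype.ext (by simp [dec_one hem hdec])
          rw [h1]
          simp [dec_one hem hdec]
        map_mul' := fun p q => by
          have h1 : (⟨(dec (p * q : Q)).1, ((hQ _).1 (p * q).2).1⟩ : orbitFixer σ τ l) =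
              ⟨(dec p).1, ((hQ p).1 p.2).1⟩ * ⟨(dec q).1, ((hQ q).1 q.2).1⟩ :=
            Subtype.ext (by simp [dec_mul hem hconj hdec hdec'])
          rw [h1, map_mul, Subgroup.coe_mul, hQl p p.2 q q.2, AddChar.map_add_eq_mul,
            smul_mul_smul_comm] }
    obtain ⟨X, hX⟩ := exists_character_eq_induced Q (FDRep.of T)
    refine ⟨X, fun g => ?_⟩
    rw [← hX]
    congr 1
    refine Finset.sum_congr rfl fun s _ => ?_
    split_ifs with h
    · have h2 : (FDRep.of T).character ⟨s * g * s⁻¹, h⟩ = LinearMap.trace ℂ W (T ⟨_, h⟩) := rfl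
      rw [h2]
      change _ = LinearMap.trace ℂ W (ε (l (dec (s * g * s⁻¹)).2) • W.ρ ⟨_, _⟩)
      rw [map_smul, smul_eq_mul, mul_comm]
      congr 1
      exact hW ⟨_, ((hQ _).1 h).1⟩
    · rfl
  obtain ⟨X, hX⟩ := exists_character_eq_sum A _ hψ
  refine ⟨X, fun g => ?_⟩
  rw [← hX, ← Finset.mul_sum, Finset.sum_comm, hcard]
  congr 1
  refine Finset.sum_congr rfl fun s _ => ?_
  simp only [hQ]
  split_ifs
  · rw [hsum, Finset.sum_mul]
  · simp

theorem orbitSum_eq_sum_sum [Fintype J] [Fintype N]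
    (hτ : ∀ a b x, τ (f (a, b)) x = (x + a * x) + (x + a * x) * b) (ε : AddChar F ℂ)
    (l : Module.Dual F J) (y : J) :
    orbitSum τ ε l y = ∑ a, ∑ b, ε (l ((y + a * y) + (y + a * y) * b)) := by
  rw [orbitSum, ← Equiv.sum_comp f, Fintype.sum_prod_type]
  simp only [hτ]

include hσ hτ in
theorem sum_ite_radical_eq_orbitSum [SMulCommClass F J J] [Fintype J] [Fintype N]
    {ε : AddChar F ℂ} (hε : ε ≠ 1) {l : Module.Dual F J} {h : L} (hh : h ∈ orbitFixer σ τ l)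
    (y : J) (q : J → J) (hq : ∀ a, a + q a + a * q a = 0) (z : J → J)
    (hz : ∀ a, z a = (σ h⁻¹ a + y + σ h⁻¹ a * y) + q a + (σ h⁻¹ a + y + σ h⁻¹ a * y) * q a) :
    ∑ a, (if ∀ w, l (z a * w) = 0 then ε (l (z a)) else 0) =
      (Fintype.card J : ℂ)⁻¹ * orbitSum τ ε l y := by
  rw [orbitSum_eq_sum_sum hτ, Finset.mul_sum]
  refine Finset.sum_congr rfl fun a _ => ?_
  set z₀ := (y + a * y) + (y + a * y) * q a with hz₀
  have h1 : z a = z₀ + (σ h⁻¹ a - a) + (σ h⁻¹ a - a) * (y + q a + y * q a) := by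
    have h2 : z a = z₀ + (σ h⁻¹ a - a) + (σ h⁻¹ a - a) * (y + q a + y * q a) +
        (a + q a + a * q a) := by
      rw [hz, hz₀]
      simp only [add_mul, mul_add, sub_mul, mul_assoc]
      abel
    rw [h2, hq, add_zero]
  have h3 : ∀ w, l ((σ h⁻¹ a - a) * w) = 0 := fun w => by
    rw [sub_mul, map_sub, apply_mul_of_mem_orbitFixer hσ hτ hh, sub_self]
  have h4 : ∀ w, l (z a * w) = l (z₀ * w) := fun w => by
    rw [h1, add_mul, add_mul, map_add, map_add, h3, mul_assoc, h3, add_zero, add_zero]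
  have h5 : l (z a) = l z₀ := by
    rw [h1, map_add, map_add, h3, map_sub, apply_of_mem_orbitFixer hh, sub_self, add_zero,
      add_zero]
  simp only [h4, h5]
  rw [ite_radical_eq_sum hε]
  congr 1
  have hsurj : Function.Bijective fun w => q a + w + q a * w := by
    refine Finite.injective_iff_bijective.1 fun w w' hww => ?_
    have h6 : ∀ w, w = (a + (q a + w + q a * w) + a * (q a + w + q a * w)) := fun w => by
      calc w = (a + q a + a * q a) + w + (a + q a + a * q a) * w := by rw [hq]; simp
        _ = _ := by
          simp only [add_mul, mul_add, mul_assoc]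
          abel
    rw [h6 w, hww, ← h6]
  refine Eq.trans ?_ (hsurj.sum_comp fun b => ε (l ((y + a * y) + (y + a * y) * b)))
  refine Finset.sum_congr rfl fun w _ => ?_
  congr 2
  rw [hz₀]
  simp only [add_mul, mul_add, mul_assoc]
  abel

include hσ hτ hem hconj hdec hdec' in
/-- The induced function in terms of the parametrization of the extension. -/
theorem sum_induced_eq_superChar [SMulCommClass F J J] [Fintype J] [Fintype N] [Fintype L]
    [Fintype G] {ε : AddChar F ℂ} (hε : ε ≠ 1) {l : Module.Dual F J} {θ : L → ℂ}
    (hθ : ∀ h, h ∉ orbitFixer σ τ l → θ h = 0) (k : L) (x : J) :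
    ∑ s : G, (if (dec (s * (ρ k * em x) * s⁻¹)).1 ∈ orbitFixer σ τ l ∧
        ∀ w, l ((dec (s * (ρ k * em x) * s⁻¹)).2 * w) = 0 then
      θ (dec (s * (ρ k * em x) * s⁻¹)).1 * ε (l (dec (s * (ρ k * em x) * s⁻¹)).2) else 0) =
      (Fintype.card J : ℂ)⁻¹ * superChar σ τ ε θ l k x := by
  have hinj : Function.Injective em := fun a b hab => by
    have h1 := hdec 1 a
    rw [hab, hdec] at h1
    exact (congrArg Prod.snd h1).symm
  have hbij : ∀ g : L, Function.Bijective (σ g) := fun g =>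
    Function.bijective_iff_has_inverse.2 ⟨σ g⁻¹, fun x => by simp, fun x => by simp⟩
  choose q hq hq' using exists_quasiinverse hem hinj
  have hsum : ∀ P : G → ℂ, ∑ s, P s = ∑ r, ∑ a, P (em a * ρ r) := fun P => by
    have he : Function.Bijective fun p : L × J => ρ p.1 * em p.2 :=
      Function.bijective_iff_has_inverse.2 ⟨dec, fun p => hdec p.1 p.2, hdec'⟩
    rw [← he.sum_comp, Fintype.sum_prod_type]
    refine Finset.sum_congr rfl fun r _ => ?_
    simp only [embedding_mul_map hconj]
    exact ((hbij r⁻¹).sum_comp fun a => P (ρ r * em a)).symm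
  have hdec2 : ∀ r a, dec (em a * ρ r * (ρ k * em x) * (em a * ρ r)⁻¹) = (r * k * r⁻¹,
      (σ (r * k * r⁻¹)⁻¹ a + σ r x + σ (r * k * r⁻¹)⁻¹ a * σ r x) + q a +
        (σ (r * k * r⁻¹)⁻¹ a + σ r x + σ (r * k * r⁻¹)⁻¹ a * σ r x) * q a) := fun r a => by
    have hqa : (em a)⁻¹ = em (q a) := inv_eq_of_mul_eq_one_right (by
      rw [hem, hq, embedding_zero hem])
    rw [← hdec, ← hem, ← hem, ← hqa, ← hconj, ← hconj]
    simp [mul_assoc]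
  rw [hsum, superChar, Finset.mul_sum]
  refine Finset.sum_congr rfl fun r _ => ?_
  simp only [hdec2]
  by_cases hr : r * k * r⁻¹ ∈ orbitFixer σ τ l
  · rw [mul_left_comm, ← sum_ite_radical_eq_orbitSum hσ hτ hε hr (σ r x) q hq _ fun a => rfl,
      Finset.mul_sum]
    simp only [hr, true_and, mul_ite, mul_zero]
  · simp [hr, hθ _ hr]

end Extension

theorem exists_conjugation_representation {F J L : Type} [Field F] [AddCommGroup J] [Module F J]
    [Group L] {lact : L → J → J} {ract : J → L → J}
    (hlactlin : ∀ h : L, IsLinearMap F (lact h))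
    (hractlin : ∀ h : L, IsLinearMap F (fun x => ract x h))
    (hlact_one : ∀ x : J, lact 1 x = x)
    (hlact_mul : ∀ h k : L, ∀ x : J, lact (h * k) x = lact h (lact k x))
    (hract_one : ∀ x : J, ract x 1 = x)
    (hract_mul : ∀ h k : L, ∀ x : J, ract x (h * k) = ract (ract x h) k)
    (hcomm : ∀ h k : L, ∀ x : J, ract (lact h x) k = lact h (ract x k)) :
    ∃ σ : Representation F L J, ∀ r x, σ r x = lact r (ract x r⁻¹) :=
  ⟨{ toFun := fun r => (hlactlin r).mk' ∘ₗ (hractlin r⁻¹).mk'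
     map_one' := LinearMap.ext fun x => by simp [hlact_one, hract_one]
     map_mul' := fun r s => LinearMap.ext fun x => by
      simp [hlact_mul, hract_mul, hcomm] }, fun _ _ => rfl⟩

theorem stmt_18
    (F : Type) [Field F] [Fintype F]
    (J : Type) [NonUnitalRing J] [Module F J]
    [SMulCommClass F J J] [IsScalarTower F J J] [Fintype J]
    (hnil : ∃ N : ℕ, ∀ x : ℕ → J,
      (List.range N).foldr (fun i acc => x i * acc) (x N) = 0)
    (L : Type) [Group L] [Fintype L]
    (lact : L → J → J) (ract : J → L → J)
    (hlactlin : ∀ h : L, IsLinearMap F (lact h))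
    (hractlin : ∀ h : L, IsLinearMap F (fun x => ract x h))
    (hlact_one : ∀ x : J, lact 1 x = x)
    (hlact_mul : ∀ h k : L, ∀ x : J, lact (h * k) x = lact h (lact k x))
    (hract_one : ∀ x : J, ract x 1 = x)
    (hract_mul : ∀ h k : L, ∀ x : J, ract x (h * k) = ract (ract x h) k)
    (hcomm : ∀ h k : L, ∀ x : J, ract (lact h x) k = lact h (ract x k))
    (hlmul : ∀ h : L, ∀ x y : J, lact h (x * y) = lact h x * y)
    (hrmul : ∀ h : L, ∀ x y : J, ract (x * y) h = x * ract y h)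
    (hmid : ∀ h : L, ∀ x y : J, x * lact h y = ract x h * y)
    (G : Type) [Group G] [Fintype G]
    (ρ : L →* G) (em : J → G)
    (hem : ∀ x y : J, em x * em y = em (x + y + x * y))
    (hsplit : Function.Bijective (fun p : L × J => ρ p.1 * em p.2))
    (hconj : ∀ (h : L) (x : J), ρ h * em x * (ρ h)⁻¹ = em (lact h (ract x h⁻¹)))
    (ε : AddChar F ℂ) (hε : ε ≠ 1)
 :
    let dec : G → L × J :=
      @Function.invFun (L × J) G ⟨(1, 0)⟩ fun p : L × J => ρ p.1 * em p.2
    let Jrt : Module.Dual F J → Set J := fun l => {z : J | ∀ w : J, l (z * w) = 0}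
    let Fix : L → Module.Dual F J → Prop := fun r μ =>
      ∀ x : J, μ (ract (lact r⁻¹ x) r) = μ x
    let IsIrrOn : Set L → (L → ℂ) → Prop := fun H ψ =>
      (∀ h : L, h ∉ H → ψ h = 0) ∧
      ∃ H₀ : Subgroup L, (H₀ : Set L) = H ∧
        ∃ W : FDRep ℂ ↥H₀, CategoryTheory.Simple W ∧
          ∀ h : ↥H₀, ψ ↑h = W.character h
    let UlaU : Module.Dual F J → Set (Module.Dual F J) := fun l =>
      {μ | ∃ (w z : J), ∀ x : J,
        μ x = l ((x + z * x) + (x + z * x) * w)}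
    let Hset : Module.Dual F J → Set L := fun l => {r : L | ∀ μ ∈ UlaU l, Fix r μ}
    let Sset : Module.Dual F J → Set L := fun l =>
      {r : L | ∀ μ ν : Module.Dual F J,
        (∀ x : J, ν x = μ (ract (lact r⁻¹ x) r)) → (μ ∈ UlaU l ↔ ν ∈ UlaU l)}
    let IsSIrr : Module.Dual F J → (L → ℂ) → Prop := fun l θ =>
      ∃ Sfin : Finset (L → ℂ),
        (∀ ψ ∈ Sfin, IsIrrOn (Hset l) ψ) ∧
        (∃ ψ₀ ∈ Sfin, ∀ ψ : L → ℂ,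
          ψ ∈ Sfin ↔ ∃ r ∈ Sset l, ∀ h : L, ψ h = ψ₀ (r * h * r⁻¹)) ∧
        ∀ h : L, θ h = ∑ ψ ∈ Sfin, ψ h
    let ξdot : (L → ℂ) → Module.Dual F J → G → ℂ := fun θ l s =>
      if (dec s).1 ∈ Hset l ∧ (dec s).2 ∈ Jrt l then
        θ (dec s).1 * ε (l (dec s).2)
      else 0
    let χ : (L → ℂ) → Module.Dual F J → G → ℂ := fun θ l g =>
      ((Nat.card ↥(Hset l) * Nat.card ↥(Jrt l) : ℕ) : ℂ)⁻¹ *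
        ∑ s : G, ξdot θ l (s * g * s⁻¹)
    let Rel : ((L → ℂ) × Module.Dual F J) → ((L → ℂ) × Module.Dual F J) → Prop :=
      fun α α' => ∃ r : L,
        (∀ ν : Module.Dual F J,
          (∀ x : J, ν x = α.2 (ract (lact r⁻¹ x) r)) → ν ∈ UlaU α'.2) ∧
        ∀ h : L, α'.1 h = α.1 (r⁻¹ * h * r)
    let Jh : L → Set J := fun h =>
      {x : J | ∀ μ : Module.Dual F J,
        (∃ ν : Module.Dual F J, μ ∈ UlaU ν ∧ ∀ σ ∈ UlaU ν, Fix h σ) → μ x = 0}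
    let orbUU : J → Set J := fun x₀ =>
      {y : J | ∃ (w w' : J),
        y = (x₀ + w * x₀) + (x₀ + w * x₀) * w'}
    let K : L × Set J → Set G := fun β =>
      {g : G | ∃ p : L, ∃ x ∈ β.2, g = ρ p * (ρ β.1 * em x) * (ρ p)⁻¹}
    let RelB : (L × Set J) → (L × Set J) → Prop := fun β β' =>
      ∃ r : L, β'.1 = r * β.1 * r⁻¹ ∧
        β'.2 = (fun x : J => lact r (ract x r⁻¹)) '' β.2
    ∀ R : Set (Module.Dual F J),
      (∀ μ : Module.Dual F J, ∃! l, l ∈ R ∧ μ ∈ UlaU l) →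
    let A0 : Set ((L → ℂ) × Module.Dual F J) :=
      {α | α.2 ∈ R ∧ IsSIrr α.2 α.1}
    let B0 : Set (L × Set J) :=
      {β | ∃ x₀ : J, β.2 = {y : J | ∃ z ∈ orbUU x₀, y - z ∈ Jh β.1}}
    let orbitsA : Set (Set ((L → ℂ) × Module.Dual F J)) :=
      {S | ∃ α ∈ A0, S = {α' ∈ A0 | Rel α α'}}
    let orbitsB : Set (Set (L × Set J)) :=
      {S | ∃ β ∈ B0, S = {β' ∈ B0 | RelB β β'}}
    (∀ α ∈ A0, ∃ W : FDRep ℂ G, ∀ g : G, χ α.1 α.2 g = W.character g) ∧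
    (∀ α ∈ A0, ∀ α' ∈ A0,
      (Rel α α' → χ α.1 α.2 = χ α'.1 α'.2) ∧
      (¬ Rel α α' →
        (Fintype.card G : ℂ)⁻¹ *
          (∑ g : G, χ α.1 α.2 g * (starRingEnd ℂ) (χ α'.1 α'.2 g)) = 0)) ∧
    (∀ g : G, ∃! S, S ∈ orbitsB ∧ ∃ β ∈ S, g ∈ K β) ∧
    (∃ β ∈ B0, K β = {1}) ∧
    (∀ α ∈ A0, ∀ β ∈ B0, ∀ g ∈ K β, ∀ g' ∈ K β, χ α.1 α.2 g = χ α.1 α.2 g') ∧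
    Nat.card ↥orbitsA = Nat.card ↥orbitsB := by
  intro dec Jrt Fix IsIrrOn UlaU Hset Sset IsSIrr ξdot χ Rel Jh orbUU K RelB R hR
    A0 B0 orbitsA orbitsB
  have hdec : ∀ h x, dec (ρ h * em x) = (h, x) := fun h x =>
    @Function.leftInverse_invFun _ _ ⟨(1, 0)⟩ _ hsplit.1 (h, x)
  have hdec' : ∀ g, ρ (dec g).1 * em (dec g).2 = g := fun g => by
    obtain ⟨⟨h, x⟩, rfl⟩ := hsplit.2 g
    dsimp only
    rw [hdec]
  have hinj : Function.Injective em := fun a b hab => by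
    have h1 := hdec 1 a
    rw [hab, hdec] at h1
    exact (congrArg Prod.snd h1).symm
  obtain ⟨σ, hσ⟩ := exists_conjugation_representation hlactlin hractlin hlact_one hlact_mul
    hract_one hract_mul hcomm
  have hσmul : ∀ r x y, σ r (x * y) = σ r x * σ r y := fun r x y => by
    rw [hσ, hσ, hσ, hrmul, hlmul, hmid, hcomm, ← hract_mul, inv_mul_cancel, hract_one]
  have hσ' : ∀ r x, ract (lact r⁻¹ x) r = σ r⁻¹ x := fun r x => by
    rw [hσ, inv_inv, hcomm]
  have hconj' : ∀ h x, ρ h * em x * (ρ h)⁻¹ = em (σ h x) := fun h x => by rw [hconj, hσ]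
  obtain ⟨f, hτ⟩ := exists_equiv_twoSided (F := F) (exists_quasiinverse hem hinj)
  set τ := twoSided F J
  let _ : Fintype ((PreQuasiregular J)ˣ × (PreQuasiregular J)ˣ) := Fintype.ofEquiv _ f
  obtain ⟨κ, hκ⟩ := exists_equiv_intertwining hσmul hτ
  have hU : ∀ l, UlaU l = dualOrbit τ l := fun l =>
    Set.ext fun μ => (mem_dualOrbit_iff_of_equiv hτ).symm
  have hH : ∀ l, Hset l = orbitFixer σ τ l := fun l => by
    ext r
    simp only [Hset, Fix, hU, hσ']
    rfl
  have hS : ∀ l, Sset l = orbitStabilizer σ τ l := fun l => by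
    ext r
    simp only [Sset, hU, hσ']
    rfl
  have hJh : ∀ h, Jh h = fixedAnnihilator σ τ h := fun h => by
    ext x
    simp only [Jh, Fix, hU, hσ']
    exact (mem_fixedAnnihilator_iff_exists σ τ).symm
  have hIrr : ∀ l θ, IsSIrr l θ ↔
      IsOrbitSumOn (orbitFixer σ τ l) (orbitStabilizer σ τ l : Set L) θ := fun l θ => by
    rw [← hH, ← hS]
    rfl
  have hcardH : ∀ l, Nat.card (Hset l) = Nat.card (orbitFixer σ τ l) := fun l => by
    rw [hH]
    rfl
  have hχ : ∀ θ l g, χ θ l g =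
      ((Nat.card (orbitFixer σ τ l) * Nat.card {z : J | ∀ w, l (z * w) = 0} : ℕ) : ℂ)⁻¹ *
        ∑ s : G, (if (dec (s * g * s⁻¹)).1 ∈ orbitFixer σ τ l ∧
            ∀ w, l ((dec (s * g * s⁻¹)).2 * w) = 0 then
          θ (dec (s * g * s⁻¹)).1 * ε (l (dec (s * g * s⁻¹)).2) else 0) := fun θ l g => by
    rw [← hcardH]
    simp only [χ, ξdot, hH]
    rfl
  have hpos : ∀ l : Module.Dual F J,
      Nat.card (orbitFixer σ τ l) * Nat.card {z : J | ∀ w, l (z * w) = 0} ≠ 0 := fun l => by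
    have : Nonempty {z : J | ∀ w, l (z * w) = 0} := ⟨⟨0, by simp⟩⟩
    exact mul_ne_zero Nat.card_pos.ne' Nat.card_pos.ne'
  have main := superChar_theory hκ ε hε (fun p : L × J => ρ p.1 * em p.2) hsplit χ
    (fun l => ((Nat.card (orbitFixer σ τ l) * Nat.card {z : J | ∀ w, l (z * w) = 0} : ℕ) : ℂ)⁻¹ *
      (Fintype.card J : ℂ)⁻¹)
    (fun l => mul_ne_zero (inv_ne_zero (Nat.cast_ne_zero.2 (hpos l)))
      (inv_ne_zero (Nat.cast_ne_zero.2 Fintype.card_ne_zero)))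
    (fun l l' t ht => by
      rw [card_radical_eq hσmul hτ ht, Nat.card_congr ((MulAut.conj t).toEquiv.subtypeEquiv
        fun h => mem_orbitFixer_iff_conj hκ ht h)])
    (fun θ l hθ k x => by
      rw [hχ, sum_induced_eq_superChar hσmul hτ hem hconj' hdec hdec' hε hθ, mul_assoc])
    R (fun μ => by
      obtain ⟨l, ⟨hl, hμ⟩, -⟩ := hR μ
      exact ⟨l, hl, hU l ▸ hμ⟩)
    A0 (fun α => and_congr_right fun _ => hIrr _ _)
    B0 (fun β => exists_congr fun x => by
      rw [show orbitBlock σ τ β.1 x = {y | ∃ z ∈ orbUU x, y - z ∈ Jh β.1} from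
        Set.ext fun y => by
          rw [mem_orbitBlock_iff_of_equiv hτ, hJh]
          rfl])
    K (fun β g => exists_congr fun p => exists_congr fun x => and_congr_right fun _ => by
      rw [map_mul, map_mul, map_inv, ← hconj']
      simp only [mul_assoc, inv_mul_cancel_left])
    Rel (fun α α' => exists_congr fun t => and_congr_left fun _ => by
      rw [← hU]
      simp only [hσ']
      exact ⟨fun h => h _ fun x => rfl, fun h ν hν => by
        rwa [show ν = σ.dual t α.2 from LinearMap.ext hν]⟩)
    RelB (fun β β' => by
      simp only [RelB, ← hσ])
  obtain ⟨h2, h3, h4, h5, h6⟩ := main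
  refine ⟨fun α hα => ?_, fun α hα α' hα' => ⟨(h2 α hα α' hα').1, fun hn => ?_⟩, h3, ?_, h5, h6⟩
  · obtain ⟨X, hX⟩ := exists_character_eq_induced_orbitSum hσmul hτ hem hconj' hdec hdec' ε _ _ _
      ((hIrr _ _).1 hα.2)
    refine ⟨X, fun g => ?_⟩
    rw [hχ, ← hX]
    congr!
  · rw [(h2 α hα α' hα').2 hn, mul_zero]
  · simpa [embedding_zero hem] using h4
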